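/- arXiv:2211.06938 — 6 statements merged into one kernel-verified Lean document; each statement's English description precedes it below -/
import Mathlib

section
/- Let L be a Lie superalgebra over a commutative ring K and let M, N be graded ideals of L. Then M⋏N ≅ (M∧N)/M₀(M,N). -/
/-!
Basic definitions for Lie superalgebras over a commutative ring `K`,
graded ideals, the nonabelian (CP) exterior products and the Bogomolov multiplier.
-/

universe u v

namespace BogomolovSuper

/-- The sign `(-1)^{|i||j|}` attached to a pair of `ℤ₂`-degrees. -/
def sgn (i j : ZMod 2) : ℤ := (-1) ^ (i.val * j.val)

/-- A Lie superalgebra structure on a `K`-module `L`: a `ℤ₂`-grading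
`gr` with `L = gr 0 ⊕ gr 1` together with a super bracket satisfying
super skew-symmetry, the super Jacobi identity and `[x,x] = 0` for even `x`. -/
structure SuperAlg (K : Type u) [CommRing K] (L : Type v)
    [AddCommGroup L] [Module K L] where
  bk : L →ₗ[K] L →ₗ[K] L
  gr : ZMod 2 → Submodule K L
  gr_inf : gr 0 ⊓ gr 1 = ⊥
  gr_sup : gr 0 ⊔ gr 1 = ⊤
  bk_gr : ∀ i j : ZMod 2, ∀ x ∈ gr i, ∀ y ∈ gr j, bk x y ∈ gr (i + j)
  skew : ∀ i j : ZMod 2, ∀ x ∈ gr i, ∀ y ∈ gr j, bk x y = -(sgn i j • bk y x)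
  jacobi : ∀ i j : ZMod 2, ∀ x ∈ gr i, ∀ y ∈ gr j, ∀ z : L,
    bk x (bk y z) = bk (bk x y) z + sgn i j • bk y (bk x z)
  even_sq : ∀ x ∈ gr 0, bk x x = 0

variable {K : Type u} [CommRing K]

section Defs

variable {L L' E : Type v} [AddCommGroup L] [Module K L]
  [AddCommGroup L'] [Module K L'] [AddCommGroup E] [Module K E]

/-- A homomorphism of Lie superalgebras of even degree (degree zero). -/
def IsSuperHom (s : SuperAlg K L) (s' : SuperAlg K L') (f : L →ₗ[K] L') : Prop :=
  (∀ x y : L, f (s.bk x y) = s'.bk (f x) (f y)) ∧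
  (∀ i : ZMod 2, ∀ x ∈ s.gr i, f x ∈ s'.gr i)

/-- A graded (homogeneous) ideal of a Lie superalgebra. -/
def IsGradedIdeal (s : SuperAlg K L) (M : Submodule K L) : Prop :=
  (∀ x : L, ∀ m ∈ M, s.bk x m ∈ M ∧ s.bk m x ∈ M) ∧
  (∀ m ∈ M, ∃ m₀ ∈ M ⊓ s.gr 0, ∃ m₁ ∈ M ⊓ s.gr 1, m = m₀ + m₁)

/-- The sub-Lie-superalgebra generated by a set: the smallest submodule
containing the set and closed under the bracket. -/
def lieSpan (s : SuperAlg K E) (S : Set E) : Submodule K E :=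
  sInf {p : Submodule K E | S ⊆ p ∧ ∀ x ∈ p, ∀ y ∈ p, s.bk x y ∈ p}

/-- `K(L)`: the set of all brackets `[a,b]`. -/
def bkSet (s : SuperAlg K L) : Set L := {x : L | ∃ a b : L, x = s.bk a b}

/-- The derived subalgebra `L² = [L,L]` (as a submodule; it is a graded ideal). -/
def derived (s : SuperAlg K L) : Submodule K L := Submodule.span K (bkSet s)

/-- The descending central series of a Lie superalgebra. -/
def lcs (s : SuperAlg K L) : ℕ → Submodule K L
  | 0 => ⊤
  | n + 1 => Submodule.span K {x : L | ∃ a ∈ lcs s n, ∃ b : L, x = s.bk a b}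

/-- Nilpotency of a Lie superalgebra. -/
def IsNilpotentSuper (s : SuperAlg K L) : Prop := ∃ c : ℕ, lcs s c = ⊥

/-- A Lie super exterior pairing on a pair of graded ideals `M`, `N` of `(L, s)`,
with values in a Lie superalgebra `(E, t)`. -/
structure IsExtPairing (s : SuperAlg K L) (M N : Submodule K L)
    (t : SuperAlg K E) (ρ : L → L → E) : Prop where
  grade : ∀ i j : ZMod 2, ∀ m ∈ M ⊓ s.gr i, ∀ n ∈ N ⊓ s.gr j, ρ m n ∈ t.gr (i + j)
  smul_left : ∀ (c : K) (i j : ZMod 2), ∀ m ∈ M ⊓ s.gr i, ∀ n ∈ N ⊓ s.gr j,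
    ρ (c • m) n = c • ρ m n
  smul_right : ∀ (c : K) (i j : ZMod 2), ∀ m ∈ M ⊓ s.gr i, ∀ n ∈ N ⊓ s.gr j,
    ρ m (c • n) = c • ρ m n
  add_left : ∀ (i j : ZMod 2), ∀ m ∈ M ⊓ s.gr i, ∀ m' ∈ M ⊓ s.gr i, ∀ n ∈ N ⊓ s.gr j,
    ρ (m + m') n = ρ m n + ρ m' n
  add_right : ∀ (i j : ZMod 2), ∀ m ∈ M ⊓ s.gr i, ∀ n ∈ N ⊓ s.gr j, ∀ n' ∈ N ⊓ s.gr j,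
    ρ m (n + n') = ρ m n + ρ m n'
  bk_left : ∀ (i i' j : ZMod 2), ∀ m ∈ M ⊓ s.gr i, ∀ m' ∈ M ⊓ s.gr i', ∀ n ∈ N ⊓ s.gr j,
    ρ (s.bk m m') n = ρ m (s.bk m' n) - sgn i i' • ρ m' (s.bk m n)
  bk_right : ∀ (i j j' : ZMod 2), ∀ m ∈ M ⊓ s.gr i, ∀ n ∈ N ⊓ s.gr j, ∀ n' ∈ N ⊓ s.gr j',
    ρ m (s.bk n n') = sgn j' (i + j) • ρ (s.bk n' m) n - sgn i j • ρ (s.bk n m) n'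
  bk_pair : ∀ (i j i' j' : ZMod 2), ∀ m ∈ M ⊓ s.gr i, ∀ n ∈ N ⊓ s.gr j,
    ∀ m' ∈ M ⊓ s.gr i', ∀ n' ∈ N ⊓ s.gr j',
    t.bk (ρ m n) (ρ m' n') = -(sgn i j • ρ (s.bk n m) (s.bk m' n'))

/-- A Lie super `B̃₀`-pairing: an exterior pairing that moreover kills the
commutativity-preserving relations. -/
structure IsB0Pairing (s : SuperAlg K L) (M N : Submodule K L)
    (t : SuperAlg K E) (ρ : L → L → E)
    extends IsExtPairing s M N t ρ : Prop where
  rel_pair : ∀ (i j i' j' : ZMod 2), ∀ m ∈ M ⊓ s.gr i, ∀ n ∈ N ⊓ s.gr j,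
    ∀ m' ∈ M ⊓ s.gr i', ∀ n' ∈ N ⊓ s.gr j',
    s.bk m n + sgn i' j' • s.bk m' n' = 0 → ρ m n + sgn i' j' • ρ m' n' = 0
  rel_even : ∀ m ∈ M ⊓ s.gr 0, ∀ n ∈ N ⊓ s.gr 0, s.bk m n = 0 → ρ m n = 0

/-- The set of wedge generators `m ∧ n` (`m`, `n` homogeneous). -/
def wedgeSet (s : SuperAlg K L) (M N : Submodule K L) (ρ : L → L → E) : Set E :=
  {e : E | ∃ i j : ZMod 2, ∃ m ∈ M ⊓ s.gr i, ∃ n ∈ N ⊓ s.gr j, e = ρ m n}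

/-- `(E, t, ρ)` is the nonabelian exterior product `M ∧ N`: `ρ` is a universal
exterior pairing whose image generates `E`. -/
structure IsExtProduct (s : SuperAlg K L) (M N : Submodule K L)
    (t : SuperAlg K E) (ρ : L → L → E) : Prop where
  pairing : IsExtPairing s M N t ρ
  gen : Submodule.span K (wedgeSet s M N ρ) = ⊤
  lift : ∀ {E' : Type v} [AddCommGroup E'] [Module K E'],
    ∀ (t' : SuperAlg K E') (ρ' : L → L → E'), IsExtPairing s M N t' ρ' →
    ∃ f : E →ₗ[K] E', IsSuperHom t t' f ∧
      ∀ (i j : ZMod 2), ∀ m ∈ M ⊓ s.gr i, ∀ n ∈ N ⊓ s.gr j, f (ρ m n) = ρ' m n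

/-- `(E, t, ρ)` is the commutativity preserving (CP) exterior product `M ⋏ N`:
`ρ` is a universal `B̃₀`-pairing whose image generates `E`. -/
structure IsCPProduct (s : SuperAlg K L) (M N : Submodule K L)
    (t : SuperAlg K E) (ρ : L → L → E) : Prop where
  pairing : IsB0Pairing s M N t ρ
  gen : Submodule.span K (wedgeSet s M N ρ) = ⊤
  lift : ∀ {E' : Type v} [AddCommGroup E'] [Module K E'],
    ∀ (t' : SuperAlg K E') (ρ' : L → L → E'), IsB0Pairing s M N t' ρ' →
    ∃ f : E →ₗ[K] E', IsSuperHom t t' f ∧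
      ∀ (i j : ZMod 2), ∀ m ∈ M ⊓ s.gr i, ∀ n ∈ N ⊓ s.gr j, f (ρ m n) = ρ' m n

/-- Generators of `M₀(M,N)` inside the exterior product. -/
def M0Set (s : SuperAlg K L) (M N : Submodule K L) (ρ : L → L → E) : Set E :=
  {e : E | ∃ i j i' j' : ZMod 2, ∃ m ∈ M ⊓ s.gr i, ∃ n ∈ N ⊓ s.gr j,
      ∃ m' ∈ M ⊓ s.gr i', ∃ n' ∈ N ⊓ s.gr j',
      s.bk m n + sgn i' j' • s.bk m' n' = 0 ∧ e = ρ m n + sgn i' j' • ρ m' n'} ∪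
  {e : E | ∃ m ∈ M ⊓ s.gr 0, ∃ n ∈ N ⊓ s.gr 0, s.bk m n = 0 ∧ e = ρ m n}

/-- `M₀(M,N)`, the graded submodule of the exterior product generated
by the commutativity-preserving relations. -/
def M0 (s : SuperAlg K L) (M N : Submodule K L) (ρ : L → L → E) : Submodule K E :=
  Submodule.span K (M0Set s M N ρ)

/-- `κ` is the commutator map `κ̃ : m ∧ n ↦ [m,n]`. -/
def IsCommMap (s : SuperAlg K L) (M N : Submodule K L) (ρ : L → L → E)
    (κ : E →ₗ[K] L) : Prop :=
  ∀ (i j : ZMod 2), ∀ m ∈ M ⊓ s.gr i, ∀ n ∈ N ⊓ s.gr j, κ (ρ m n) = s.bk m n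

/-- The Bogomolov multiplier `B̃₀(L) = M(L)/M₀(L)` of `(L,s)` is trivial:
for any realization of the exterior product `L ∧ L` and of the commutator
map `κ̃`, the kernel `M(L)` of `κ̃` is contained in `M₀(L)`. -/
def HasTrivialBog (s : SuperAlg K L) : Prop :=
  ∀ {E' : Type v} [AddCommGroup E'] [Module K E'],
    ∀ (t : SuperAlg K E') (w : L → L → E'), IsExtProduct s ⊤ ⊤ t w →
    ∀ κ : E' →ₗ[K] L, IsCommMap s ⊤ ⊤ w κ → LinearMap.ker κ ≤ M0 s ⊤ ⊤ w

end Defs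

section Free

variable {F : Type v} [AddCommGroup F] [Module K F]

/-- `(F, sF)` is the free Lie superalgebra on the `ℤ₂`-graded set `X`. -/
structure IsFreeSuper (sF : SuperAlg K F) (X : ZMod 2 → Set F) : Prop where
  subset : ∀ i : ZMod 2, X i ⊆ sF.gr i
  gen : lieSpan sF (X 0 ∪ X 1) = ⊤
  lift : ∀ {M : Type v} [AddCommGroup M] [Module K M],
    ∀ (sM : SuperAlg K M) (f : F → M), (∀ i : ZMod 2, ∀ x ∈ X i, f x ∈ sM.gr i) →
    ∃ g : F →ₗ[K] M, IsSuperHom sF sM g ∧ ∀ x ∈ X 0 ∪ X 1, g x = f x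

end Free

end BogomolovSuper

namespace BogomolovSuper

section Hom

variable {K : Type u} [CommRing K] {L E E' : Type v} [AddCommGroup L] [Module K L]
  [AddCommGroup E] [Module K E] [AddCommGroup E'] [Module K E']
  {s : SuperAlg K L} {M N : Submodule K L} {t : SuperAlg K E} {t' : SuperAlg K E'}
  {ρ : L → L → E} {ρ' : L → L → E'}

/-- Composing an exterior pairing with a Lie superalgebra homomorphism gives an exterior
pairing. -/
theorem IsExtPairing.comp_hom (h : IsExtPairing s M N t ρ) {f : E →ₗ[K] E'}
    (hf : IsSuperHom t t' f) : IsExtPairing s M N t' fun m n => f (ρ m n) where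
  grade i j m hm n hn := hf.2 _ _ (h.grade i j m hm n hn)
  smul_left c i j m hm n hn := by rw [h.smul_left c i j m hm n hn, map_smul]
  smul_right c i j m hm n hn := by rw [h.smul_right c i j m hm n hn, map_smul]
  add_left i j m hm m' hm' n hn := by rw [h.add_left i j m hm m' hm' n hn, map_add]
  add_right i j m hm n hn n' hn' := by rw [h.add_right i j m hm n hn n' hn', map_add]
  bk_left i i' j m hm m' hm' n hn := by
    rw [h.bk_left i i' j m hm m' hm' n hn, map_sub, map_zsmul]
  bk_right i j j' m hm n hn n' hn' := by
    rw [h.bk_right i j j' m hm n hn n' hn', map_sub, map_zsmul, map_zsmul]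
  bk_pair i j i' j' m hm n hn m' hm' n' hn' := by
    rw [← hf.1, h.bk_pair i j i' j' m hm n hn m' hm' n' hn', map_neg, map_zsmul]

/-- A homomorphism killing `M₀(M,N)` turns an exterior pairing into a `B̃₀`-pairing. -/
theorem IsExtPairing.isB0Pairing_comp_hom (h : IsExtPairing s M N t ρ) {f : E →ₗ[K] E'}
    (hf : IsSuperHom t t' f) (hker : M0 s M N ρ ≤ LinearMap.ker f) :
    IsB0Pairing s M N t' fun m n => f (ρ m n) where
  toIsExtPairing := h.comp_hom hf
  rel_pair i j i' j' m hm n hn m' hm' n' hn' hr := by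
    rw [← map_zsmul, ← map_add]
    exact hker (Submodule.subset_span
      (Or.inl ⟨i, j, i', j', m, hm, n, hn, m', hm', n', hn', hr, rfl⟩))
  rel_even m hm n hn hr := hker (Submodule.subset_span (Or.inr ⟨m, hm, n, hn, hr, rfl⟩))

/-- A linear map carrying a pairing to a `B̃₀`-pairing kills `M₀(M,N)`. -/
theorem IsB0Pairing.M0_le_ker (h : IsB0Pairing s M N t' ρ') {g : E →ₗ[K] E'}
    (hg : ∀ i j : ZMod 2, ∀ m ∈ M ⊓ s.gr i, ∀ n ∈ N ⊓ s.gr j, g (ρ m n) = ρ' m n) :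
    M0 s M N ρ ≤ LinearMap.ker g := by
  refine Submodule.span_le.2 ?_
  rintro _ (⟨i, j, i', j', m, hm, n, hn, m', hm', n', hn', hr, rfl⟩ | ⟨m, hm, n, hn, hr, rfl⟩)
  · rw [SetLike.mem_coe, LinearMap.mem_ker, map_add, map_zsmul, hg i j m hm n hn,
      hg i' j' m' hm' n' hn']
    exact h.rel_pair i j i' j' m hm n hn m' hm' n' hn' hr
  · rw [SetLike.mem_coe, LinearMap.mem_ker, hg 0 0 m hm n hn]
    exact h.rel_even m hm n hn hr

/-- A linear map whose values include a spanning set of wedge generators is surjective. -/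
theorem surjective_of_span_wedgeSet (hgen : Submodule.span K (wedgeSet s M N ρ') = ⊤)
    {g : E →ₗ[K] E'}
    (hg : ∀ i j : ZMod 2, ∀ m ∈ M ⊓ s.gr i, ∀ n ∈ N ⊓ s.gr j, g (ρ m n) = ρ' m n) :
    Function.Surjective g := by
  rw [← LinearMap.range_eq_top, eq_top_iff, ← hgen, Submodule.span_le]
  rintro _ ⟨i, j, m, hm, n, hn, rfl⟩
  exact ⟨ρ m n, hg i j m hm n hn⟩

end Hom

/-- For graded ideals `M`, `N` of a Lie superalgebra `(L,s)`,
`M ⋏ N ≅ (M ∧ N)/M₀(M,N)`: given a realization `(E, tC, c)` of the CP exterior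
product `M ⋏ N`, a realization `(E', tW, w)` of the exterior product `M ∧ N`, and
a quotient `(Q, tQ)` of `M ∧ N` by the graded submodule `M₀(M,N)` (i.e. a surjective
Lie superalgebra homomorphism `q` with kernel `M₀(M,N)`), there is an isomorphism
of Lie superalgebras `M ⋏ N ≅ Q` sending `m ⋏ n` to the class of `m ∧ n`. -/
theorem cp_product_iso_ext_product_mod_M0
    {K : Type u} [CommRing K] {L E E' Q : Type v}
    [AddCommGroup L] [Module K L] [AddCommGroup E] [Module K E]
    [AddCommGroup E'] [Module K E'] [AddCommGroup Q] [Module K Q]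
    (s : SuperAlg K L) (M N : Submodule K L)
    (hM : IsGradedIdeal s M) (hN : IsGradedIdeal s N)
    (tC : SuperAlg K E) (c : L → L → E) (hC : IsCPProduct s M N tC c)
    (tW : SuperAlg K E') (w : L → L → E') (hW : IsExtProduct s M N tW w)
    (tQ : SuperAlg K Q) (q : E' →ₗ[K] Q) (hq : IsSuperHom tW tQ q)
    (hqsurj : Function.Surjective q) (hqker : LinearMap.ker q = M0 s M N w) :
    ∃ f : E →ₗ[K] Q, IsSuperHom tC tQ f ∧ Function.Bijective f ∧
      ∀ (i j : ZMod 2), ∀ m ∈ M ⊓ s.gr i, ∀ n ∈ N ⊓ s.gr j,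
        f (c m n) = q (w m n) := by
  obtain ⟨f, hf, hfc⟩ := hC.lift tQ _ (hW.pairing.isB0Pairing_comp_hom hq hqker.ge)
  obtain ⟨g, -, hgw⟩ := hW.lift tC c hC.pairing.toIsExtPairing
  have hfg : f ∘ₗ g = q := by
    refine LinearMap.ext_on hW.gen ?_
    rintro _ ⟨i, j, m, hm, n, hn, rfl⟩
    rw [LinearMap.comp_apply, hgw i j m hm n hn, hfc i j m hm n hn]
  refine ⟨f, hf, ⟨(injective_iff_map_eq_zero f).2 fun x hx => ?_, ?_⟩, hfc⟩
  · obtain ⟨y, rfl⟩ := surjective_of_span_wedgeSet hC.gen hgw x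
    have hy : y ∈ LinearMap.ker q := by rwa [← hfg]
    exact hC.pairing.M0_le_ker hgw (hqker ▸ hy)
  · refine Function.Surjective.of_comp (g := g) ?_
    rwa [← LinearMap.coe_comp, hfg]

end BogomolovSuper
end

section
/- Let L be a Lie superalgebra over a commutative ring K and let M, N, K′ be graded ideals of L with K′ ⊆ M ∩ N. Then (M/K′)⋏(N/K′) ≅ (M⋏N)/T, where T is the sub Lie superalgebra of M⋏N generated by all elements m⋏n + (−1)^{|m′||n′|} m′⋏n′ with [m,n] + (−1)^{|m′||n′|}[m′,n′] ∈ K′ (m,m′ ∈ M, n,n′ ∈ N homogeneous) together with all m₀⋏n₀ with m₀ ∈ M₀, n₀ ∈ N₀ and [m₀,n₀] ∈ K′. -/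
/-!
Basic definitions for Lie superalgebras over a commutative ring `K`,
graded ideals, the nonabelian (CP) exterior products and the Bogomolov multiplier.
-/

universe u v

namespace BogomolovSuper

lemma sgn_mul_self (i j : ZMod 2) : sgn i j * sgn i j = 1 := by
  rw [sgn, ← mul_pow]; simp

section QuotientProduct

variable {K : Type u} [CommRing K] {L L' E : Type v} [AddCommGroup L] [Module K L]
  [AddCommGroup L'] [Module K L'] [AddCommGroup E] [Module K E]

lemma SuperAlg.eq_zero_of_mem_gr_of_ne (s : SuperAlg K L) {i j : ZMod 2} (hij : i ≠ j) {x : L}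
    (hi : x ∈ s.gr i) (hj : x ∈ s.gr j) : x = 0 := by
  have h : x ∈ s.gr 0 ⊓ s.gr 1 := by
    fin_cases i <;> fin_cases j
    · exact absurd rfl hij
    · exact ⟨hi, hj⟩
    · exact ⟨hj, hi⟩
    · exact absurd rfl hij
  rwa [s.gr_inf, Submodule.mem_bot] at h

/-- The quotient of a Lie superalgebra by a graded ideal. -/
def SuperAlg.quotient (s : SuperAlg K L) (I : Submodule K L) (hI : IsGradedIdeal s I) :
    SuperAlg K (L ⧸ I) where
  bk := I.liftQ
    (I.liftQ (s.bk.compr₂ I.mkQ).flip (fun y hy => by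
      ext x
      simpa using (hI.1 x y hy).1)).flip
    (fun x hx => by
      ext y
      exact (Submodule.Quotient.mk_eq_zero I).2 (hI.1 y x hx).2)
  gr i := (s.gr i).map I.mkQ
  gr_inf := by
    rw [eq_bot_iff]
    rintro _ ⟨⟨a, ha, rfl⟩, b, hb, hab⟩
    have hd : a - b ∈ I := (Submodule.Quotient.eq I).1 hab.symm
    obtain ⟨u, hu, v, hv, huv⟩ := hI.2 _ hd
    have hau : a - u = b + v := by
      rw [sub_eq_iff_eq_add] at huv ⊢; rw [huv]; abel
    have h0 : a - u = 0 := s.eq_zero_of_mem_gr_of_ne zero_ne_one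
      (sub_mem ha hu.2) (hau ▸ add_mem hb hv.2)
    rw [Submodule.mem_bot, Submodule.mkQ_apply, Submodule.Quotient.mk_eq_zero, sub_eq_zero.1 h0]
    exact hu.1
  gr_sup := by
    rw [← Submodule.map_sup, s.gr_sup, Submodule.map_top, Submodule.range_mkQ]
  bk_gr := by
    rintro i j _ ⟨x, hx, rfl⟩ _ ⟨y, hy, rfl⟩
    exact ⟨_, s.bk_gr i j x hx y hy, rfl⟩
  skew := by
    rintro i j _ ⟨x, hx, rfl⟩ _ ⟨y, hy, rfl⟩
    refine (congrArg I.mkQ (s.skew i j x hx y hy)).trans ?_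
    rw [map_neg, map_zsmul]
    rfl
  jacobi := by
    rintro i j _ ⟨x, hx, rfl⟩ _ ⟨y, hy, rfl⟩ z
    obtain ⟨z, rfl⟩ := I.mkQ_surjective z
    refine (congrArg I.mkQ (s.jacobi i j x hx y hy z)).trans ?_
    rw [map_add, map_zsmul]
    rfl
  even_sq := by
    rintro _ ⟨x, hx, rfl⟩
    exact (congrArg I.mkQ (s.even_sq x hx)).trans (map_zero _)

@[simp]
lemma SuperAlg.quotient_bk_mkQ (s : SuperAlg K L) (I : Submodule K L) (hI : IsGradedIdeal s I)
    (x y : L) : (s.quotient I hI).bk (I.mkQ x) (I.mkQ y) = I.mkQ (s.bk x y) := rfl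

lemma IsGradedIdeal.bk_left_mem {s : SuperAlg K L} {M : Submodule K L} (hM : IsGradedIdeal s M)
    {i j : ZMod 2} {m x : L} (hm : m ∈ M ⊓ s.gr i) (hx : x ∈ s.gr j) :
    s.bk m x ∈ M ⊓ s.gr (i + j) :=
  ⟨(hM.1 x m hm.1).2, s.bk_gr _ _ _ hm.2 _ hx⟩

lemma IsGradedIdeal.bk_right_mem {s : SuperAlg K L} {M : Submodule K L} (hM : IsGradedIdeal s M)
    {i j : ZMod 2} {x m : L} (hx : x ∈ s.gr i) (hm : m ∈ M ⊓ s.gr j) :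
    s.bk x m ∈ M ⊓ s.gr (i + j) :=
  ⟨(hM.1 x m hm.1).1, s.bk_gr _ _ _ hx _ hm.2⟩

/-- A homogeneous element of the image of a graded ideal has a homogeneous preimage. -/
lemma IsGradedIdeal.exists_lift {s : SuperAlg K L} {s' : SuperAlg K L'} {M : Submodule K L}
    (hM : IsGradedIdeal s M) {p : L →ₗ[K] L'} (hp : IsSuperHom s s' p) {i : ZMod 2} {x : L'}
    (hx : x ∈ M.map p ⊓ s'.gr i) : ∃ m ∈ M ⊓ s.gr i, p m = x := by
  obtain ⟨⟨m, hm, rfl⟩, hi⟩ := hx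
  obtain ⟨a, ha, b, hb, rfl⟩ := hM.2 m hm
  have hpa := hp.2 _ _ ha.2
  have hpb := hp.2 _ _ hb.2
  rw [map_add] at hi ⊢
  fin_cases i
  · refine ⟨a, ha, ?_⟩
    rw [s'.eq_zero_of_mem_gr_of_ne zero_ne_one ((Submodule.add_mem_iff_right _ hpa).1 hi) hpb,
      add_zero]
  · refine ⟨b, hb, ?_⟩
    rw [s'.eq_zero_of_mem_gr_of_ne zero_ne_one hpa ((Submodule.add_mem_iff_left _ hpb).1 hi),
      zero_add]

lemma IsSuperHom.map_mem {s : SuperAlg K L} {s' : SuperAlg K L'} {M : Submodule K L}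
    {p : L →ₗ[K] L'} (hp : IsSuperHom s s' p) {i : ZMod 2} {m : L} (hm : m ∈ M ⊓ s.gr i) :
    p m ∈ M.map p ⊓ s'.gr i :=
  ⟨⟨m, hm.1, rfl⟩, hp.2 _ _ hm.2⟩

section Pairing

variable {s : SuperAlg K L} {M N : Submodule K L} {t : SuperAlg K E} {ρ : L → L → E}

lemma IsExtPairing.zsmul_left (h : IsExtPairing s M N t ρ) (ε : ℤ) {i j : ZMod 2} {m n : L}
    (hm : m ∈ M ⊓ s.gr i) (hn : n ∈ N ⊓ s.gr j) : ρ (ε • m) n = ε • ρ m n := by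
  rw [← Int.cast_smul_eq_zsmul K ε m, h.smul_left _ i j m hm n hn, Int.cast_smul_eq_zsmul]

/-- The bracket of two wedges is the wedge of their commutators. -/
lemma IsExtPairing.bk_wedge (h : IsExtPairing s M N t ρ) (hM : IsGradedIdeal s M)
    (hN : IsGradedIdeal s N) {i j i' j' : ZMod 2} {m n m' n' : L}
    (hm : m ∈ M ⊓ s.gr i) (hn : n ∈ N ⊓ s.gr j) (hm' : m' ∈ M ⊓ s.gr i') (hn' : n' ∈ N ⊓ s.gr j') :
    t.bk (ρ m n) (ρ m' n') = ρ (s.bk m n) (s.bk m' n') := by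
  rw [h.bk_pair i j i' j' m hm n hn m' hm' n' hn', s.skew i j m hm.2 n hn.2, ← neg_smul, ← neg_smul,
    h.zsmul_left _ (hM.bk_right_mem hn.2 hm) (hN.bk_right_mem hm'.2 hn')]

end Pairing

/-- The elements `m ∧ n + (-1)^{|m'||n'|} m' ∧ n'` with `[m,n] + (-1)^{|m'||n'|}[m',n'] ∈ I`,
and the even `m₀ ∧ n₀` with `[m₀,n₀] ∈ I`. -/
def bracketRelSet (s : SuperAlg K L) (M N I : Submodule K L) (ρ : L → L → E) : Set E :=
  {e : E | ∃ i j i' j' : ZMod 2, ∃ m ∈ M ⊓ s.gr i, ∃ n ∈ N ⊓ s.gr j,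
      ∃ m' ∈ M ⊓ s.gr i', ∃ n' ∈ N ⊓ s.gr j',
      s.bk m n + sgn i' j' • s.bk m' n' ∈ I ∧
      e = ρ m n + sgn i' j' • ρ m' n'} ∪
  {e : E | ∃ m ∈ M ⊓ s.gr 0, ∃ n ∈ N ⊓ s.gr 0, s.bk m n ∈ I ∧ e = ρ m n}

section BracketRel

variable {s : SuperAlg K L} {M N I : Submodule K L} {t : SuperAlg K E} {ρ : L → L → E}

lemma IsExtPairing.add_zsmul_mem_span (h : IsExtPairing s M N t ρ) (ε : ℤ)
    {i j i' j' : ZMod 2} {m n m' n' : L}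
    (hm : m ∈ M ⊓ s.gr i) (hn : n ∈ N ⊓ s.gr j) (hm' : m' ∈ M ⊓ s.gr i') (hn' : n' ∈ N ⊓ s.gr j')
    (hI : s.bk m n + ε • s.bk m' n' ∈ I) :
    ρ m n + ε • ρ m' n' ∈ Submodule.span K (bracketRelSet s M N I ρ) := by
  refine Submodule.subset_span (Or.inl ⟨i, j, i', j', m, hm, n, hn, (sgn i' j' * ε) • m',
    zsmul_mem hm' _, n', hn', ?_, ?_⟩)
  · rwa [map_zsmul, LinearMap.smul_apply, smul_smul, ← mul_assoc, sgn_mul_self, one_mul]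
  · rw [h.zsmul_left _ hm' hn', smul_smul, ← mul_assoc, sgn_mul_self, one_mul]

lemma IsExtPairing.mem_span (h : IsExtPairing s M N t ρ) {i j : ZMod 2} {m n : L}
    (hm : m ∈ M ⊓ s.gr i) (hn : n ∈ N ⊓ s.gr j) (hI : s.bk m n ∈ I) :
    ρ m n ∈ Submodule.span K (bracketRelSet s M N I ρ) := by
  simpa using h.add_zsmul_mem_span 0 hm hn hm hn (by simpa using hI)

/-- To check a property of a bracket relator it suffices to treat the general sums
`m ∧ n + ε m' ∧ n'`. -/
lemma bracketRelSet_induction {F : Type v} [AddCommGroup F] {ρ : L → L → F} {C : F → Prop}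
    (hC : ∀ (i j i' j' : ZMod 2) (ε : ℤ), ∀ m ∈ M ⊓ s.gr i, ∀ n ∈ N ⊓ s.gr j,
      ∀ m' ∈ M ⊓ s.gr i', ∀ n' ∈ N ⊓ s.gr j',
      s.bk m n + ε • s.bk m' n' ∈ I → C (ρ m n + ε • ρ m' n')) :
    ∀ e ∈ bracketRelSet s M N I ρ, C e := by
  rintro _ (⟨i, j, i', j', m, hm, n, hn, m', hm', n', hn', hI, rfl⟩ | ⟨m, hm, n, hn, hI, rfl⟩)
  · exact hC i j i' j' _ m hm n hn m' hm' n' hn' hI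
  · simpa using hC 0 0 0 0 0 m hm n hn m hm n hn (by simpa using hI)

/-- Over a generating pairing, the bracket relators span a graded ideal. -/
lemma IsExtPairing.isGradedIdeal_span_bracketRelSet (h : IsExtPairing s M N t ρ)
    (hgen : Submodule.span K (wedgeSet s M N ρ) = ⊤)
    (hM : IsGradedIdeal s M) (hN : IsGradedIdeal s N) (hI : IsGradedIdeal s I) :
    IsGradedIdeal t (Submodule.span K (bracketRelSet s M N I ρ)) := by
  set T := Submodule.span K (bracketRelSet s M N I ρ)
  constructor
  · intro x e he
    have hx : x ∈ Submodule.span K (wedgeSet s M N ρ) := hgen ▸ Submodule.mem_top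
    induction hx using Submodule.span_induction with
    | zero => simp
    | add x y _ _ hx hy =>
      simp only [map_add, LinearMap.add_apply]
      exact ⟨add_mem hx.1 hy.1, add_mem hx.2 hy.2⟩
    | smul a x _ hx =>
      simp only [map_smul, LinearMap.smul_apply]
      exact ⟨T.smul_mem _ hx.1, T.smul_mem _ hx.2⟩
    | mem x hx =>
      obtain ⟨k, l, a, ha, b, hb, rfl⟩ := hx
      suffices hT : T ≤ T.comap (t.bk (ρ a b)) ⊓ T.comap (t.bk.flip (ρ a b)) from hT he
      refine Submodule.span_le.2 (bracketRelSet_induction ?_)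
      intro i j i' j' ε m hm n hn m' hm' n' hn' hmem
      constructor
      · simp only [SetLike.mem_coe, Submodule.mem_comap, map_add, map_zsmul]
        rw [h.bk_wedge hM hN ha hb hm hn, h.bk_wedge hM hN ha hb hm' hn']
        refine h.add_zsmul_mem_span ε (hM.bk_left_mem ha hb.2) (hN.bk_right_mem hm.2 hn)
          (hM.bk_left_mem ha hb.2) (hN.bk_right_mem hm'.2 hn') ?_
        simpa using (hI.1 (s.bk a b) _ hmem).1
      · simp only [SetLike.mem_coe, Submodule.mem_comap, map_add, map_zsmul, LinearMap.flip_apply]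
        rw [h.bk_wedge hM hN hm hn ha hb, h.bk_wedge hM hN hm' hn' ha hb]
        refine h.add_zsmul_mem_span ε (hM.bk_left_mem hm hn.2) (hN.bk_right_mem ha.2 hb)
          (hM.bk_left_mem hm' hn'.2) (hN.bk_right_mem ha.2 hb) ?_
        simpa using (hI.1 (s.bk a b) _ hmem).2
  · suffices hT : T ≤ (T ⊓ t.gr 0) ⊔ (T ⊓ t.gr 1) by
      intro e he
      obtain ⟨a, ha, b, hb, hab⟩ := Submodule.mem_sup.1 (hT he)
      exact ⟨a, ha, b, hb, hab.symm⟩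
    have hom : ∀ (i : ZMod 2) (e : E), e ∈ T → e ∈ t.gr i → e ∈ (T ⊓ t.gr 0) ⊔ (T ⊓ t.gr 1) := by
      intro i e he hi
      fin_cases i
      · exact Submodule.mem_sup_left ⟨he, hi⟩
      · exact Submodule.mem_sup_right ⟨he, hi⟩
    refine Submodule.span_le.2 (bracketRelSet_induction ?_)
    intro i j i' j' ε m hm n hn m' hm' n' hn' hmem
    have hg := h.grade i j m hm n hn
    have hg' := zsmul_mem (h.grade i' j' m' hm' n' hn') ε
    by_cases hd : i + j = i' + j'
    · exact hom (i + j) _ (h.add_zsmul_mem_span ε hm hn hm' hn' hmem) (add_mem hg (hd ▸ hg'))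
    · have hb := s.bk_gr i j m hm.2 n hn.2
      have hb' := zsmul_mem (s.bk_gr i' j' m' hm'.2 n' hn'.2) ε
      have hmn : s.bk m n ∈ I := by
        obtain ⟨u, hu, v, hv, huv⟩ := hI.2 _ hmem
        have key : ∀ {k l : ZMod 2}, k ≠ l → ∀ {x y u v : L}, x ∈ s.gr k → y ∈ s.gr l →
            u ∈ s.gr k → v ∈ s.gr l → x + y = u + v → x = u := by
          intro k l hkl x y u v hx hy hu hv hxy
          refine sub_eq_zero.1 (s.eq_zero_of_mem_gr_of_ne hkl (sub_mem hx hu) ?_)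
          rw [show x - u = v - y by rw [sub_eq_sub_iff_add_eq_add, hxy, add_comm]]
          exact sub_mem hv hy
        generalize i + j = k at *
        generalize i' + j' = l at *
        fin_cases k <;> fin_cases l
        · exact absurd rfl hd
        · rw [key zero_ne_one hb hb' hu.2 hv.2 huv]; exact hu.1
        · rw [key one_ne_zero hb hb' hv.2 hu.2 (huv.trans (add_comm _ _))]; exact hv.1
        · exact absurd rfl hd
      have h1 := h.mem_span hm hn hmn
      have h2 : ε • ρ m' n' ∈ T :=
        (Submodule.add_mem_iff_right _ h1).1 (h.add_zsmul_mem_span ε hm hn hm' hn' hmem)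
      exact add_mem (hom _ _ h1 hg) (hom _ _ h2 hg')

end BracketRel

lemma lieSpan_eq_span {t : SuperAlg K E} {S : Set E}
    (h : ∀ x ∈ Submodule.span K S, ∀ y ∈ Submodule.span K S, t.bk x y ∈ Submodule.span K S) :
    lieSpan t S = Submodule.span K S :=
  le_antisymm (sInf_le ⟨Submodule.subset_span, h⟩)
    (le_sInf fun _ hq => Submodule.span_le.2 hq.1)

section QuotientPairing

variable {s : SuperAlg K L} {s' : SuperAlg K L'} {M N : Submodule K L} {t : SuperAlg K E}
  {ρ : L → L → E} {p : L →ₗ[K] L'}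

/-- The wedges of homogeneous elements with commutators congruent modulo `ker p` agree modulo
the bracket relators. -/
lemma IsExtPairing.mkQ_eq_mkQ (h : IsExtPairing s M N t ρ) {i j i' j' : ZMod 2} {m n m' n' : L}
    (hm : m ∈ M ⊓ s.gr i) (hn : n ∈ N ⊓ s.gr j) (hm' : m' ∈ M ⊓ s.gr i') (hn' : n' ∈ N ⊓ s.gr j')
    (hI : p (s.bk m n) = p (s.bk m' n')) :
    (Submodule.span K (bracketRelSet s M N (LinearMap.ker p) ρ)).mkQ (ρ m n) =
      (Submodule.span K (bracketRelSet s M N (LinearMap.ker p) ρ)).mkQ (ρ m' n') := by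
  refine (Submodule.Quotient.eq _).2 ?_
  have := h.add_zsmul_mem_span (I := LinearMap.ker p) (-1) hm hn hm' hn' (by simp [hI])
  simpa [sub_eq_add_neg] using this

open Classical in
/-- The pairing induced on the image of `p` by a pairing `ρ`, with values modulo the bracket
relators of `ker p`, computed on homogeneous preimages. -/
noncomputable def quotientPairing (s : SuperAlg K L) (M N : Submodule K L) (ρ : L → L → E)
    (p : L →ₗ[K] L') (x y : L') :
    E ⧸ Submodule.span K (bracketRelSet s M N (LinearMap.ker p) ρ) :=
  if h : ∃ (m n : L) (i j : ZMod 2), m ∈ M ⊓ s.gr i ∧ n ∈ N ⊓ s.gr j ∧ p m = x ∧ p n = y then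
    Submodule.mkQ _ (ρ h.choose h.choose_spec.choose) else 0

lemma IsExtPairing.quotientPairing_apply (h : IsExtPairing s M N t ρ) (hp : IsSuperHom s s' p)
    {i j : ZMod 2} {m n : L} (hm : m ∈ M ⊓ s.gr i) (hn : n ∈ N ⊓ s.gr j) :
    quotientPairing s M N ρ p (p m) (p n) = Submodule.mkQ _ (ρ m n) := by
  have hex : ∃ (m' n' : L) (i j : ZMod 2),
      m' ∈ M ⊓ s.gr i ∧ n' ∈ N ⊓ s.gr j ∧ p m' = p m ∧ p n' = p n := ⟨m, n, i, j, hm, hn, rfl, rfl⟩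
  obtain ⟨_, _, hm', hn', hpm, hpn⟩ := hex.choose_spec.choose_spec
  rw [quotientPairing, dif_pos hex]
  refine h.mkQ_eq_mkQ hm' hn' hm hn ?_
  rw [hp.1, hp.1]
  exact congrArg₂ (fun x y => s'.bk x y) hpm hpn

/-- The induced pairing on the images of graded ideals is a `B̃₀`-pairing. -/
lemma IsExtPairing.isB0Pairing_quotientPairing (h : IsExtPairing s M N t ρ)
    (hM : IsGradedIdeal s M) (hN : IsGradedIdeal s N) (hp : IsSuperHom s s' p)
    (hT : IsGradedIdeal t (Submodule.span K (bracketRelSet s M N (LinearMap.ker p) ρ))) :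
    IsB0Pairing s' (M.map p) (N.map p) (t.quotient _ hT) (quotientPairing s M N ρ p) where
  grade i j x hx y hy := by
    obtain ⟨m, hm, rfl⟩ := hM.exists_lift hp hx
    obtain ⟨n, hn, rfl⟩ := hN.exists_lift hp hy
    rw [h.quotientPairing_apply hp hm hn]
    exact ⟨_, h.grade i j m hm n hn, rfl⟩
  smul_left a i j x hx y hy := by
    obtain ⟨m, hm, rfl⟩ := hM.exists_lift hp hx
    obtain ⟨n, hn, rfl⟩ := hN.exists_lift hp hy
    rw [← map_smul, h.quotientPairing_apply hp hm hn,
      h.quotientPairing_apply hp (Submodule.smul_mem _ a hm) hn, h.smul_left a i j m hm n hn,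
      map_smul]
  smul_right a i j x hx y hy := by
    obtain ⟨m, hm, rfl⟩ := hM.exists_lift hp hx
    obtain ⟨n, hn, rfl⟩ := hN.exists_lift hp hy
    rw [← map_smul, h.quotientPairing_apply hp hm hn,
      h.quotientPairing_apply hp hm (Submodule.smul_mem _ a hn), h.smul_right a i j m hm n hn,
      map_smul]
  add_left i j x hx x' hx' y hy := by
    obtain ⟨m, hm, rfl⟩ := hM.exists_lift hp hx
    obtain ⟨m', hm', rfl⟩ := hM.exists_lift hp hx'
    obtain ⟨n, hn, rfl⟩ := hN.exists_lift hp hy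
    rw [← map_add, h.quotientPairing_apply hp hm hn, h.quotientPairing_apply hp hm' hn,
      h.quotientPairing_apply hp (add_mem hm hm') hn, h.add_left i j m hm m' hm' n hn, map_add]
  add_right i j x hx y hy y' hy' := by
    obtain ⟨m, hm, rfl⟩ := hM.exists_lift hp hx
    obtain ⟨n, hn, rfl⟩ := hN.exists_lift hp hy
    obtain ⟨n', hn', rfl⟩ := hN.exists_lift hp hy'
    rw [← map_add, h.quotientPairing_apply hp hm hn, h.quotientPairing_apply hp hm hn',
      h.quotientPairing_apply hp hm (add_mem hn hn'), h.add_right i j m hm n hn n' hn', map_add]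
  bk_left i i' j x hx x' hx' y hy := by
    obtain ⟨m, hm, rfl⟩ := hM.exists_lift hp hx
    obtain ⟨m', hm', rfl⟩ := hM.exists_lift hp hx'
    obtain ⟨n, hn, rfl⟩ := hN.exists_lift hp hy
    rw [← hp.1, ← hp.1, ← hp.1, h.quotientPairing_apply hp (hM.bk_left_mem hm hm'.2) hn,
      h.quotientPairing_apply hp hm (hN.bk_right_mem hm'.2 hn),
      h.quotientPairing_apply hp hm' (hN.bk_right_mem hm.2 hn),
      h.bk_left i i' j m hm m' hm' n hn, map_sub, map_zsmul]
  bk_right i j j' x hx y hy y' hy' := by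
    obtain ⟨m, hm, rfl⟩ := hM.exists_lift hp hx
    obtain ⟨n, hn, rfl⟩ := hN.exists_lift hp hy
    obtain ⟨n', hn', rfl⟩ := hN.exists_lift hp hy'
    rw [← hp.1, ← hp.1, ← hp.1, h.quotientPairing_apply hp hm (hN.bk_left_mem hn hn'.2),
      h.quotientPairing_apply hp (hM.bk_right_mem hn'.2 hm) hn,
      h.quotientPairing_apply hp (hM.bk_right_mem hn.2 hm) hn',
      h.bk_right i j j' m hm n hn n' hn', map_sub, map_zsmul, map_zsmul]
  bk_pair i j i' j' x hx y hy x' hx' y' hy' := by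
    obtain ⟨m, hm, rfl⟩ := hM.exists_lift hp hx
    obtain ⟨n, hn, rfl⟩ := hN.exists_lift hp hy
    obtain ⟨m', hm', rfl⟩ := hM.exists_lift hp hx'
    obtain ⟨n', hn', rfl⟩ := hN.exists_lift hp hy'
    rw [← hp.1, ← hp.1, h.quotientPairing_apply hp hm hn, h.quotientPairing_apply hp hm' hn',
      h.quotientPairing_apply hp (hM.bk_right_mem hn.2 hm) (hN.bk_right_mem hm'.2 hn'),
      SuperAlg.quotient_bk_mkQ, h.bk_pair i j i' j' m hm n hn m' hm' n' hn', map_neg, map_zsmul]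
  rel_pair i j i' j' x hx y hy x' hx' y' hy' hrel := by
    obtain ⟨m, hm, rfl⟩ := hM.exists_lift hp hx
    obtain ⟨n, hn, rfl⟩ := hN.exists_lift hp hy
    obtain ⟨m', hm', rfl⟩ := hM.exists_lift hp hx'
    obtain ⟨n', hn', rfl⟩ := hN.exists_lift hp hy'
    rw [h.quotientPairing_apply hp hm hn, h.quotientPairing_apply hp hm' hn', ← map_zsmul,
      ← map_add]
    refine (Submodule.Quotient.mk_eq_zero _).2 (h.add_zsmul_mem_span _ hm hn hm' hn' ?_)
    rw [LinearMap.mem_ker, map_add, map_zsmul, hp.1, hp.1, hrel]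
  rel_even x hx y hy hrel := by
    obtain ⟨m, hm, rfl⟩ := hM.exists_lift hp hx
    obtain ⟨n, hn, rfl⟩ := hN.exists_lift hp hy
    rw [h.quotientPairing_apply hp hm hn]
    refine (Submodule.Quotient.mk_eq_zero _).2 (h.mem_span hm hn ?_)
    rw [LinearMap.mem_ker, hp.1, hrel]

end QuotientPairing

end QuotientProduct

/-- Let `M`, `N`, `K'` be graded ideals of a Lie superalgebra `(L,s)`
with `K' ≤ M ⊓ N`.  Then `(M/K') ⋏ (N/K') ≅ (M ⋏ N)/T`, where `T` is the sub-Lie-superalgebra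
of `M ⋏ N` generated by the elements `m ⋏ n + (-1)^{|m'||n'|} m' ⋏ n'` with
`[m,n] + (-1)^{|m'||n'|}[m',n'] ∈ K'`, together with the `m₀ ⋏ n₀` (`m₀, n₀` even) with
`[m₀,n₀] ∈ K'`.  Here `L/K'` is realized by a surjective homomorphism `p` with kernel `K'`,
`M/K' = p(M)`, `N/K' = p(N)`, and the isomorphism is expressed by saying that the canonical
homomorphism `M ⋏ N → (M/K') ⋏ (N/K')`, `m ⋏ n ↦ (m + K') ⋏ (n + K')`, is surjective
with kernel exactly `T`. -/
theorem cp_product_of_quotient_ideals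
    {K : Type u} [CommRing K] {L L' E E' : Type v}
    [AddCommGroup L] [Module K L] [AddCommGroup L'] [Module K L']
    [AddCommGroup E] [Module K E] [AddCommGroup E'] [Module K E']
    (s : SuperAlg K L) (M N K' : Submodule K L)
    (hM : IsGradedIdeal s M) (hN : IsGradedIdeal s N) (hK' : IsGradedIdeal s K')
    (hK'MN : K' ≤ M ⊓ N)
    (s' : SuperAlg K L') (p : L →ₗ[K] L') (hp : IsSuperHom s s' p)
    (hpsurj : Function.Surjective p) (hpker : LinearMap.ker p = K')
    (tC : SuperAlg K E) (c : L → L → E) (hC : IsCPProduct s M N tC c)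
    (tC' : SuperAlg K E') (c' : L' → L' → E')
    (hC' : IsCPProduct s' (M.map p) (N.map p) tC' c')
    (f : E →ₗ[K] E') (hf : IsSuperHom tC tC' f)
    (hfc : ∀ (i j : ZMod 2), ∀ m ∈ M ⊓ s.gr i, ∀ n ∈ N ⊓ s.gr j,
      f (c m n) = c' (p m) (p n)) :
    Function.Surjective f ∧
    LinearMap.ker f = lieSpan tC (
      {e : E | ∃ i j i' j' : ZMod 2, ∃ m ∈ M ⊓ s.gr i, ∃ n ∈ N ⊓ s.gr j,
          ∃ m' ∈ M ⊓ s.gr i', ∃ n' ∈ N ⊓ s.gr j',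
          s.bk m n + sgn i' j' • s.bk m' n' ∈ K' ∧
          e = c m n + sgn i' j' • c m' n'} ∪
      {e : E | ∃ m ∈ M ⊓ s.gr 0, ∃ n ∈ N ⊓ s.gr 0, s.bk m n ∈ K' ∧ e = c m n}) := by
  subst hpker
  have hT := hC.pairing.toIsExtPairing.isGradedIdeal_span_bracketRelSet hC.gen hM hN hK'
  change _ ∧ LinearMap.ker f = lieSpan tC (bracketRelSet s M N (LinearMap.ker p) c)
  rw [lieSpan_eq_span fun x _ y hy => (hT.1 x y hy).1]
  refine ⟨?_, le_antisymm ?_ ?_⟩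
  · rw [← LinearMap.range_eq_top, eq_top_iff, ← hC'.gen, Submodule.span_le]
    rintro _ ⟨i, j, x, hx, y, hy, rfl⟩
    obtain ⟨m, hm, rfl⟩ := hM.exists_lift hp hx
    obtain ⟨n, hn, rfl⟩ := hN.exists_lift hp hy
    exact ⟨c m n, hfc i j m hm n hn⟩
  · obtain ⟨g, -, hg⟩ := hC'.lift _ _
      (hC.pairing.toIsExtPairing.isB0Pairing_quotientPairing hM hN hp hT)
    have hgf : g ∘ₗ f = Submodule.mkQ _ := by
      refine LinearMap.ext_on hC.gen ?_
      rintro _ ⟨i, j, m, hm, n, hn, rfl⟩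
      rw [LinearMap.comp_apply, hfc i j m hm n hn, hg i j _ (hp.map_mem hm) _ (hp.map_mem hn),
        hC.pairing.toIsExtPairing.quotientPairing_apply hp hm hn]
    intro e he
    rw [← Submodule.ker_mkQ (Submodule.span K _), ← hgf, LinearMap.mem_ker, LinearMap.comp_apply,
      LinearMap.mem_ker.1 he, map_zero]
  · rw [Submodule.span_le]
    rintro _ (⟨i, j, i', j', m, hm, n, hn, m', hm', n', hn', hI, rfl⟩ | ⟨m, hm, n, hn, hI, rfl⟩)
    · rw [SetLike.mem_coe, LinearMap.mem_ker, map_add, map_zsmul, hfc i j m hm n hn,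
        hfc i' j' m' hm' n' hn']
      refine hC'.pairing.rel_pair i j i' j' _ (hp.map_mem hm) _ (hp.map_mem hn)
        _ (hp.map_mem hm') _ (hp.map_mem hn') ?_
      rw [← hp.1, ← hp.1, ← map_zsmul, ← map_add]
      exact hI
    · rw [SetLike.mem_coe, LinearMap.mem_ker, hfc 0 0 m hm n hn]
      refine hC'.pairing.rel_even _ (hp.map_mem hm) _ (hp.map_mem hn) ?_
      rw [← hp.1]
      exact hI

end BogomolovSuper
end

section
/- Let M and N be two graded ideals of a Lie superalgebra L over a commutative ring K with L = M ⊕ N (direct sum of ideals). Then (M ⊕ N)⋏(M ⊕ N) ≅ (M⋏M) ⊕ (N⋏N). -/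
/-!
Basic definitions for Lie superalgebras over a commutative ring `K`,
graded ideals, the nonabelian (CP) exterior products and the Bogomolov multiplier.
-/

universe u v

namespace BogomolovSuper

section CPProductDirectSum

variable {K : Type u} [CommRing K] {L E E' : Type v} [AddCommGroup L] [Module K L]
  [AddCommGroup E] [Module K E] [AddCommGroup E'] [Module K E']

/-- The direct sum of two Lie superalgebras, with componentwise bracket and grading. -/
def SuperAlg.prod (t : SuperAlg K E) (t' : SuperAlg K E') : SuperAlg K (E × E') where
  bk := LinearMap.mk₂ K (fun x y => (t.bk x.1 y.1, t'.bk x.2 y.2))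
    (by intros; simp) (by intros; simp) (by intros; simp) (by intros; simp)
  gr i := (t.gr i).prod (t'.gr i)
  gr_inf := by
    rw [Submodule.prod_inf_prod, t.gr_inf, t'.gr_inf, Submodule.prod_bot]
  gr_sup := by
    rw [Submodule.prod_sup_prod, t.gr_sup, t'.gr_sup, Submodule.prod_top]
  bk_gr i j x hx y hy :=
    ⟨t.bk_gr i j _ hx.1 _ hy.1, t'.bk_gr i j _ hx.2 _ hy.2⟩
  skew i j x hx y hy :=
    Prod.ext (t.skew i j _ hx.1 _ hy.1) (t'.skew i j _ hx.2 _ hy.2)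
  jacobi i j x hx y hy z :=
    Prod.ext (t.jacobi i j _ hx.1 _ hy.1 _) (t'.jacobi i j _ hx.2 _ hy.2 _)
  even_sq x hx := Prod.ext (t.even_sq _ hx.1) (t'.even_sq _ hx.2)

variable {s : SuperAlg K L} {M N M' N' : Submodule K L} {t : SuperAlg K E} {t' : SuperAlg K E'}
  {ρ : L → L → E} {ρ' : L → L → E'}

theorem IsB0Pairing.prod (h : IsB0Pairing s M N t ρ) (h' : IsB0Pairing s M N t' ρ') :
    IsB0Pairing s M N (t.prod t') (fun x y => (ρ x y, ρ' x y)) where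
  grade i j m hm n hn := ⟨h.grade i j m hm n hn, h'.grade i j m hm n hn⟩
  smul_left c i j m hm n hn :=
    Prod.ext (h.smul_left c i j m hm n hn) (h'.smul_left c i j m hm n hn)
  smul_right c i j m hm n hn :=
    Prod.ext (h.smul_right c i j m hm n hn) (h'.smul_right c i j m hm n hn)
  add_left i j m hm m' hm' n hn :=
    Prod.ext (h.add_left i j m hm m' hm' n hn) (h'.add_left i j m hm m' hm' n hn)
  add_right i j m hm n hn n' hn' :=
    Prod.ext (h.add_right i j m hm n hn n' hn') (h'.add_right i j m hm n hn n' hn')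
  bk_left i i' j m hm m' hm' n hn :=
    Prod.ext (h.bk_left i i' j m hm m' hm' n hn) (h'.bk_left i i' j m hm m' hm' n hn)
  bk_right i j j' m hm n hn n' hn' :=
    Prod.ext (h.bk_right i j j' m hm n hn n' hn') (h'.bk_right i j j' m hm n hn n' hn')
  bk_pair i j i' j' m hm n hn m' hm' n' hn' :=
    Prod.ext (h.bk_pair i j i' j' m hm n hn m' hm' n' hn')
      (h'.bk_pair i j i' j' m hm n hn m' hm' n' hn')
  rel_pair i j i' j' m hm n hn m' hm' n' hn' e :=
    Prod.ext (h.rel_pair i j i' j' m hm n hn m' hm' n' hn' e)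
      (h'.rel_pair i j i' j' m hm n hn m' hm' n' hn' e)
  rel_even m hm n hn e := Prod.ext (h.rel_even m hm n hn e) (h'.rel_even m hm n hn e)

/-- Pulling a `B̃₀`-pairing back along an endomorphism of Lie superalgebras. -/
theorem IsB0Pairing.comp (h : IsB0Pairing s M N t ρ) {p : L →ₗ[K] L} (hp : IsSuperHom s s p)
    (hM : ∀ x ∈ M', p x ∈ M) (hN : ∀ x ∈ N', p x ∈ N) :
    IsB0Pairing s M' N' t (fun x y => ρ (p x) (p y)) := by
  have hM' : ∀ i, ∀ x ∈ M' ⊓ s.gr i, p x ∈ M ⊓ s.gr i := fun i x hx =>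
    ⟨hM x hx.1, hp.2 i x hx.2⟩
  have hN' : ∀ i, ∀ x ∈ N' ⊓ s.gr i, p x ∈ N ⊓ s.gr i := fun i x hx =>
    ⟨hN x hx.1, hp.2 i x hx.2⟩
  constructor
  · constructor
    · exact fun i j m hm n hn => h.grade i j _ (hM' i m hm) _ (hN' j n hn)
    · intro c i j m hm n hn
      simpa using h.smul_left c i j _ (hM' i m hm) _ (hN' j n hn)
    · intro c i j m hm n hn
      simpa using h.smul_right c i j _ (hM' i m hm) _ (hN' j n hn)
    · intro i j m hm m' hm' n hn
      simpa using h.add_left i j _ (hM' i m hm) _ (hM' i m' hm') _ (hN' j n hn)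
    · intro i j m hm n hn n' hn'
      simpa using h.add_right i j _ (hM' i m hm) _ (hN' j n hn) _ (hN' j n' hn')
    · intro i i' j m hm m' hm' n hn
      simpa only [hp.1] using h.bk_left i i' j _ (hM' i m hm) _ (hM' i' m' hm') _ (hN' j n hn)
    · intro i j j' m hm n hn n' hn'
      simpa only [hp.1] using h.bk_right i j j' _ (hM' i m hm) _ (hN' j n hn) _ (hN' j' n' hn')
    · intro i j i' j' m hm n hn m' hm' n' hn'
      simpa only [hp.1] using h.bk_pair i j i' j' _ (hM' i m hm) _ (hN' j n hn)
        _ (hM' i' m' hm') _ (hN' j' n' hn')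
  · intro i j i' j' m hm n hn m' hm' n' hn' e
    refine h.rel_pair i j i' j' _ (hM' i m hm) _ (hN' j n hn)
      _ (hM' i' m' hm') _ (hN' j' n' hn') ?_
    rw [← hp.1, ← hp.1, ← map_zsmul, ← map_add, e, map_zero]
  · intro m hm n hn e
    refine h.rel_even _ (hM' 0 m hm) _ (hN' 0 n hn) ?_
    rw [← hp.1, e, map_zero]

theorem IsB0Pairing.mono (h : IsB0Pairing s M N t ρ) (hM : M' ≤ M) (hN : N' ≤ N) :
    IsB0Pairing s M' N' t ρ :=
  h.comp (p := LinearMap.id) ⟨fun _ _ => rfl, fun _ _ hx => hx⟩ hM hN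

theorem IsExtPairing.zero_zero (h : IsExtPairing s M N t ρ) : ρ 0 0 = 0 := by
  simpa using h.smul_left 0 0 0 0 (zero_mem _) 0 (zero_mem _)

/-- A `B̃₀`-pairing vanishes on every commuting pair of homogeneous elements,
whatever their degrees. -/
theorem IsB0Pairing.eq_zero_of_bk_eq_zero (h : IsB0Pairing s M N t ρ) {i j : ZMod 2} {m n : L}
    (hm : m ∈ M ⊓ s.gr i) (hn : n ∈ N ⊓ s.gr j) (e : s.bk m n = 0) : ρ m n = 0 := by
  simpa [h.zero_zero] using
    h.rel_pair i j 0 0 m hm n hn 0 (zero_mem _) 0 (zero_mem _) (by simp [e])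

theorem IsGradedIdeal.bk_eq_zero (hM : IsGradedIdeal s M) (hN : IsGradedIdeal s N)
    (hd : Disjoint M N) {m n : L} (hm : m ∈ M) (hn : n ∈ N) : s.bk m n = 0 :=
  Submodule.disjoint_def.mp hd _ (hM.1 n m hm).2 (hN.1 m n hn).1

theorem SuperAlg.disjoint_gr (s : SuperAlg K L) (i : ZMod 2) :
    Disjoint (s.gr i) (s.gr (i + 1)) := by
  fin_cases i
  · exact disjoint_iff.mpr s.gr_inf
  · exact (disjoint_iff.mpr s.gr_inf).symm

theorem IsGradedIdeal.exists_gr_add (hM : IsGradedIdeal s M) (i : ZMod 2) {m : L} (hm : m ∈ M) :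
    ∃ a ∈ M ⊓ s.gr i, ∃ b ∈ M ⊓ s.gr (i + 1), m = a + b := by
  obtain ⟨a, ha, b, hb, e⟩ := hM.2 m hm
  fin_cases i
  · exact ⟨a, ha, b, hb, e⟩
  · exact ⟨b, hb, a, ha, by rw [e, add_comm]⟩

/-- The projection onto a direct summand of a Lie superalgebra is a homomorphism. -/
theorem IsGradedIdeal.isSuperHom_projection (hM : IsGradedIdeal s M) (hN : IsGradedIdeal s N)
    (hc : IsCompl M N) : IsSuperHom s s (M.projection N hc) := by
  have hproj : ∀ m ∈ M, ∀ n ∈ N, M.projection N hc (m + n) = m := fun m hm n hn => by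
    rw [map_add, Submodule.projection_apply_of_mem_right hc hn, add_zero]
    exact Submodule.projection_apply_of_mem_left hc hm
  have hdec : ∀ x : L, ∃ m ∈ M, ∃ n ∈ N, m + n = x := fun x =>
    Submodule.mem_sup.mp (hc.sup_eq_top ▸ Submodule.mem_top)
  refine ⟨fun x y => ?_, fun i x hx => ?_⟩
  · obtain ⟨m, hm, n, hn, rfl⟩ := hdec x
    obtain ⟨m', hm', n', hn', rfl⟩ := hdec y
    have e : s.bk (m + n) (m' + n') = s.bk m m' + s.bk n n' := by
      simp [hM.bk_eq_zero hN hc.disjoint hm hn', hN.bk_eq_zero hM hc.disjoint.symm hn hm']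
    rw [e, hproj m hm n hn, hproj m' hm' n' hn',
      hproj _ (hM.1 m m' hm').1 _ (hN.1 n n' hn').1]
  · obtain ⟨m, hm, n, hn, rfl⟩ := hdec x
    obtain ⟨a, ha, b, hb, rfl⟩ := hM.exists_gr_add i hm
    obtain ⟨c, hc', d, hd, rfl⟩ := hN.exists_gr_add i hn
    have hbd : b + d ∈ s.gr i := by
      have := sub_mem hx (add_mem ha.2 hc'.2)
      rwa [show a + b + (c + d) - (a + c) = b + d by abel] at this
    have hbd0 : b + d = 0 :=
      Submodule.disjoint_def.mp (s.disjoint_gr i) _ hbd (add_mem hb.2 hd.2)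
    have hb0 : b = 0 := Submodule.disjoint_def.mp hc.disjoint _ hb.1
      (by rw [eq_neg_of_add_eq_zero_left hbd0]; exact neg_mem hd.1)
    rw [hproj _ hm _ hn, hb0, add_zero]
    exact ha.2

/-- Linear maps out of a CP exterior product agree once they agree on the wedges `m ⋏ n`. -/
theorem IsCPProduct.hom_ext (h : IsCPProduct s M N t ρ) {f g : E →ₗ[K] E'}
    (hfg : ∀ i j : ZMod 2, ∀ m ∈ M ⊓ s.gr i, ∀ n ∈ N ⊓ s.gr j, f (ρ m n) = g (ρ m n)) :
    f = g := by
  refine LinearMap.ext_on h.gen ?_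
  rintro _ ⟨i, j, m, hm, n, hn, rfl⟩
  exact hfg i j m hm n hn

end CPProductDirectSum

/-- Let `M` and `N` be graded ideals of a Lie superalgebra `(L,s)`
with `L = M ⊕ N` (internal direct sum of ideals).  Then
`(M ⊕ N) ⋏ (M ⊕ N) ≅ (M ⋏ M) ⊕ (N ⋏ N)`: for realizations of the CP exterior
products `L ⋏ L`, `M ⋏ M` and `N ⋏ N` there is a linear bijection
`L ⋏ L ≃ (M ⋏ M) × (N ⋏ N)` which preserves the brackets and the gradings
componentwise, i.e. an isomorphism onto the direct sum Lie superalgebra. -/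
theorem cp_product_of_direct_sum
    {K : Type u} [CommRing K] {L E E' E'' : Type v}
    [AddCommGroup L] [Module K L] [AddCommGroup E] [Module K E]
    [AddCommGroup E'] [Module K E'] [AddCommGroup E''] [Module K E'']
    (s : SuperAlg K L) (M N : Submodule K L)
    (hM : IsGradedIdeal s M) (hN : IsGradedIdeal s N)
    (hinf : M ⊓ N = ⊥) (hsup : M ⊔ N = ⊤)
    (tL : SuperAlg K E) (wL : L → L → E) (hL : IsCPProduct s ⊤ ⊤ tL wL)
    (tM : SuperAlg K E') (wM : L → L → E') (hMM : IsCPProduct s M M tM wM)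
    (tN : SuperAlg K E'') (wN : L → L → E'') (hNN : IsCPProduct s N N tN wN) :
    ∃ f : E →ₗ[K] E' × E'', Function.Bijective f ∧
      (∀ x y : E, f (tL.bk x y) = (tM.bk (f x).1 (f y).1, tN.bk (f x).2 (f y).2)) ∧
      (∀ i : ZMod 2, Submodule.map f (tL.gr i) = (tM.gr i).prod (tN.gr i)) := by
  have hc : IsCompl M N := ⟨disjoint_iff.mpr hinf, codisjoint_iff.mpr hsup⟩
  have hp := hM.isSuperHom_projection hN hc
  have hq := hN.isSuperHom_projection hM hc.symm
  obtain ⟨f, hf, hfw⟩ := hL.lift (tM.prod tN) _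
    ((hMM.pairing.comp (M' := ⊤) (N' := ⊤) hp
      (fun x _ => Submodule.projection_apply_mem hc x)
      (fun x _ => Submodule.projection_apply_mem hc x)).prod
    (hNN.pairing.comp (M' := ⊤) (N' := ⊤) hq
      (fun x _ => Submodule.projection_apply_mem hc.symm x)
      (fun x _ => Submodule.projection_apply_mem hc.symm x)))
  obtain ⟨g, hg, hgw⟩ := hMM.lift tL wL (hL.pairing.mono le_top le_top)
  obtain ⟨g', hg', hgw'⟩ := hNN.lift tL wL (hL.pairing.mono le_top le_top)
  have projM : ∀ m ∈ M, M.projection N hc m = m := fun m hm =>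
    Submodule.projection_apply_of_mem_left hc hm
  have projM' : ∀ m ∈ M, N.projection M hc.symm m = 0 := fun m hm =>
    Submodule.projection_apply_of_mem_right hc.symm hm
  have projN : ∀ n ∈ N, N.projection M hc.symm n = n := fun n hn =>
    Submodule.projection_apply_of_mem_left hc.symm hn
  have projN' : ∀ n ∈ N, M.projection N hc n = 0 := fun n hn =>
    Submodule.projection_apply_of_mem_right hc hn
  have hfg : f ∘ₗ g = LinearMap.inl K E' E'' := hMM.hom_ext fun i j m hm n hn => by
    simp [hgw i j m hm n hn, hfw i j m ⟨trivial, hm.2⟩ n ⟨trivial, hn.2⟩, projM m hm.1,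
      projM n hn.1, projM' m hm.1, projM' n hn.1, hNN.pairing.zero_zero]
  have hfg' : f ∘ₗ g' = LinearMap.inr K E' E'' := hNN.hom_ext fun i j m hm n hn => by
    simp [hgw' i j m hm n hn, hfw i j m ⟨trivial, hm.2⟩ n ⟨trivial, hn.2⟩, projN m hm.1,
      projN n hn.1, projN' m hm.1, projN' n hn.1, hMM.pairing.zero_zero]
  have hright : ∀ z, f (g.coprod g' z) = z := fun z => by
    rw [LinearMap.coprod_apply, map_add, ← LinearMap.comp_apply, ← LinearMap.comp_apply f,
      hfg, hfg']
    simp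
  have hleft : g.coprod g' ∘ₗ f = LinearMap.id := hL.hom_ext fun i j x hx y hy => by
    have hxM := hp.2 i x hx.2
    have hxN := hq.2 i x hx.2
    have hyM := hp.2 j y hy.2
    have hyN := hq.2 j y hy.2
    have mM := fun x => Submodule.projection_apply_mem hc x
    have mN := fun x => Submodule.projection_apply_mem hc.symm x
    have hadd : ∀ z, M.projection N hc z + N.projection M hc.symm z = z := fun z =>
      Submodule.projection_add_projection_eq_self hc z
    rw [LinearMap.comp_apply, hfw i j x hx y hy, LinearMap.coprod_apply,
      hgw i j _ ⟨mM x, hxM⟩ _ ⟨mM y, hyM⟩, hgw' i j _ ⟨mN x, hxN⟩ _ ⟨mN y, hyN⟩,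
      LinearMap.id_apply]
    conv_rhs => rw [← hadd x, ← hadd y]
    rw [hL.pairing.add_left i j _ ⟨trivial, hxM⟩ _ ⟨trivial, hxN⟩ _
        ⟨trivial, add_mem hyM hyN⟩,
      hL.pairing.add_right i j _ ⟨trivial, hxM⟩ _ ⟨trivial, hyM⟩ _ ⟨trivial, hyN⟩,
      hL.pairing.add_right i j _ ⟨trivial, hxN⟩ _ ⟨trivial, hyM⟩ _ ⟨trivial, hyN⟩,
      hL.pairing.eq_zero_of_bk_eq_zero ⟨trivial, hxM⟩ ⟨trivial, hyN⟩
        (hM.bk_eq_zero hN hc.disjoint (mM x) (mN y)),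
      hL.pairing.eq_zero_of_bk_eq_zero ⟨trivial, hxN⟩ ⟨trivial, hyM⟩
        (hN.bk_eq_zero hM hc.disjoint.symm (mN x) (mM y)), add_zero, zero_add]
  have hinv : Function.LeftInverse (g.coprod g') f := LinearMap.congr_fun hleft
  refine ⟨f, ⟨hinv.injective,
    Function.RightInverse.surjective hright⟩, hf.1, fun i => le_antisymm ?_ fun z hz => ?_⟩
  · exact Submodule.map_le_iff_le_comap.mpr fun x hx => hf.2 i x hx
  · exact ⟨g.coprod g' z, add_mem (hg.2 i _ hz.1) (hg'.2 i _ hz.2), hright z⟩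

end BogomolovSuper
end

section
/- Let L be a Lie superalgebra with a free presentation 0 → R → F →^π L → 0 and let T be a graded ideal of F containing R, with M = T/R the corresponding ideal of L. Then the sequence B̃₀(L) → B̃₀(L/M) → M/⟨K(L) ∩ M⟩ → L/L² → (L/M)/(L/M)² → 0 is exact. -/
/-!
Basic definitions for Lie superalgebras over a commutative ring `K`,
graded ideals, the nonabelian (CP) exterior products and the Bogomolov multiplier.
-/

universe u v

namespace BogomolovSuper

section Helpers

variable {K : Type u} [CommRing K] {L L' : Type v} [AddCommGroup L] [Module K L]
  [AddCommGroup L'] [Module K L']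

theorem subset_lieSpan (s : SuperAlg K L) (S : Set L) : S ⊆ lieSpan s S := by
  intro x hx
  simp only [lieSpan, SetLike.mem_coe, Submodule.mem_sInf]
  exact fun p hp => hp.1 hx

theorem lieSpan_le {s : SuperAlg K L} {S : Set L} {p : Submodule K L} (hS : S ⊆ p)
    (hp : ∀ x ∈ p, ∀ y ∈ p, s.bk x y ∈ p) : lieSpan s S ≤ p :=
  sInf_le ⟨hS, hp⟩

theorem bk_mem_lieSpan (s : SuperAlg K L) (S : Set L) {x y : L} (hx : x ∈ lieSpan s S)
    (hy : y ∈ lieSpan s S) : s.bk x y ∈ lieSpan s S := by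
  simp only [lieSpan, Submodule.mem_sInf] at hx hy ⊢
  exact fun p hp => hp.2 x (hx p hp) y (hy p hp)

theorem bk_mem_derived (s : SuperAlg K L) (x y : L) : s.bk x y ∈ derived s :=
  Submodule.subset_span ⟨x, y, rfl⟩

theorem lieSpan_bkSet_inter_le (s : SuperAlg K L) {T : Submodule K L} (hT : IsGradedIdeal s T) :
    lieSpan s (bkSet s ∩ (T : Set L)) ≤ T ⊓ derived s := by
  refine lieSpan_le ?_ fun x _ y hy => ⟨(hT.1 x y hy.1).1, bk_mem_derived s x y⟩
  rintro _ ⟨⟨a, b, rfl⟩, hx⟩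
  exact ⟨hx, bk_mem_derived s a b⟩

/-- A surjective homomorphism maps the derived subalgebra onto the derived subalgebra. -/
theorem map_derived {s : SuperAlg K L} {s' : SuperAlg K L'} {f : L →ₗ[K] L'}
    (hf : IsSuperHom s s' f) (hfs : Function.Surjective f) :
    (derived s).map f = derived s' := by
  rw [derived, derived, Submodule.map_span]
  congr 1
  ext x
  constructor
  · rintro ⟨_, ⟨a, b, rfl⟩, rfl⟩
    exact ⟨f a, f b, hf.1 a b⟩
  · rintro ⟨a, b, rfl⟩
    obtain ⟨a, rfl⟩ := hfs a
    obtain ⟨b, rfl⟩ := hfs b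
    exact ⟨s.bk a b, ⟨a, b, rfl⟩, hf.1 a b⟩

theorem mem_of_map_mem_map {f : L →ₗ[K] L'} {T : Submodule K L} (hT : LinearMap.ker f ≤ T)
    {x : L} (hx : f x ∈ T.map f) : x ∈ T := by
  obtain ⟨t, ht, hxt⟩ := hx
  simpa using add_mem ht (hT (show x - t ∈ LinearMap.ker f by simp [hxt]))

/-- Under a surjective homomorphism with kernel inside `T`, every element of
`⟨K(L') ∩ f(T)⟩` lifts to `⟨K(L) ∩ T⟩`. -/
theorem lieSpan_bkSet_inter_map_le {s : SuperAlg K L} {s' : SuperAlg K L'} {f : L →ₗ[K] L'}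
    (hf : IsSuperHom s s' f) (hfs : Function.Surjective f) {T : Submodule K L}
    (hT : LinearMap.ker f ≤ T) :
    lieSpan s' (bkSet s' ∩ (T.map f : Set L')) ≤
      (lieSpan s (bkSet s ∩ (T : Set L))).map f := by
  refine lieSpan_le ?_ ?_
  · rintro _ ⟨⟨a, b, rfl⟩, hx⟩
    obtain ⟨a, rfl⟩ := hfs a
    obtain ⟨b, rfl⟩ := hfs b
    rw [← hf.1] at hx ⊢
    exact ⟨_, subset_lieSpan _ _ ⟨⟨a, b, rfl⟩, mem_of_map_mem_map hT hx⟩, rfl⟩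
  · rintro _ ⟨x, hx, rfl⟩ _ ⟨y, hy, rfl⟩
    exact ⟨_, bk_mem_lieSpan _ _ hx hy, hf.1 x y⟩

end Helpers

/-- Let `L` be a Lie superalgebra with free presentation
`0 → R → F →π L → 0` and let `T` be a graded ideal of `F` with `R ≤ T`, and
`M = T/R = π(T)` the corresponding ideal of `L`.  Then the sequence
`B̃₀(L) → B̃₀(L/M) → M/⟨K(L) ∩ M⟩ → L/L² → (L/M)/(L/M)² → 0`
is exact.  By the Hopf-type formula, `B̃₀(L) = (R ∩ F²)/⟨K(F) ∩ R⟩` and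
`B̃₀(L/M) = (T ∩ F²)/⟨K(F) ∩ T⟩`; `L/M` is realized by a surjective homomorphism
`p : L → Q` with kernel `M`, and the maps `f1, f2, f3, f4` are the canonical ones. -/
theorem five_term_exact_sequence
    {K : Type u} [CommRing K] {L F Q : Type v}
    [AddCommGroup L] [Module K L] [AddCommGroup F] [Module K F]
    [AddCommGroup Q] [Module K Q]
    (s : SuperAlg K L)
    (sF : SuperAlg K F) (X : ZMod 2 → Set F) (hF : IsFreeSuper sF X)
    (π : F →ₗ[K] L) (hπ : IsSuperHom sF s π) (hπs : Function.Surjective π)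
    (T : Submodule K F) (hT : IsGradedIdeal sF T) (hRT : LinearMap.ker π ≤ T)
    (sQ : SuperAlg K Q) (p : L →ₗ[K] Q) (hp : IsSuperHom s sQ p)
    (hps : Function.Surjective p) (hpker : LinearMap.ker p = T.map π)
    (f1 : (↥(LinearMap.ker π ⊓ derived sF) ⧸
        Submodule.comap (LinearMap.ker π ⊓ derived sF).subtype
          (lieSpan sF (bkSet sF ∩ (LinearMap.ker π : Set F)))) →ₗ[K]
      (↥(T ⊓ derived sF) ⧸
        Submodule.comap (T ⊓ derived sF).subtype
          (lieSpan sF (bkSet sF ∩ (T : Set F)))))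
    (hf1 : ∀ (a : F) (ha : a ∈ LinearMap.ker π ⊓ derived sF) (ha' : a ∈ T ⊓ derived sF),
      f1 (Submodule.Quotient.mk ⟨a, ha⟩) = Submodule.Quotient.mk ⟨a, ha'⟩)
    (f2 : (↥(T ⊓ derived sF) ⧸
        Submodule.comap (T ⊓ derived sF).subtype
          (lieSpan sF (bkSet sF ∩ (T : Set F)))) →ₗ[K]
      (↥(T.map π) ⧸
        Submodule.comap (T.map π).subtype
          (lieSpan s (bkSet s ∩ (T.map π : Set L)))))
    (hf2 : ∀ (a : F) (ha : a ∈ T ⊓ derived sF) (ha' : π a ∈ T.map π),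
      f2 (Submodule.Quotient.mk ⟨a, ha⟩) = Submodule.Quotient.mk ⟨π a, ha'⟩)
    (f3 : (↥(T.map π) ⧸
        Submodule.comap (T.map π).subtype
          (lieSpan s (bkSet s ∩ (T.map π : Set L)))) →ₗ[K]
      (L ⧸ derived s))
    (hf3 : ∀ (b : L) (hb : b ∈ T.map π),
      f3 (Submodule.Quotient.mk ⟨b, hb⟩) = Submodule.Quotient.mk b)
    (f4 : (L ⧸ derived s) →ₗ[K] (Q ⧸ derived sQ))
    (hf4 : ∀ b : L, f4 (Submodule.Quotient.mk b) = Submodule.Quotient.mk (p b)) :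
    LinearMap.range f1 = LinearMap.ker f2 ∧
    LinearMap.range f2 = LinearMap.ker f3 ∧
    LinearMap.range f3 = LinearMap.ker f4 ∧
    Function.Surjective f4 := by
  refine ⟨?_, ?_, ?_, ?_⟩
  · apply le_antisymm
    · rintro _ ⟨y, rfl⟩
      obtain ⟨⟨a, ha⟩, rfl⟩ := Submodule.Quotient.mk_surjective _ y
      have ha' : a ∈ T ⊓ derived sF := ⟨hRT ha.1, ha.2⟩
      rw [LinearMap.mem_ker, hf1 a ha ha', hf2 a ha' ⟨a, ha'.1, rfl⟩,
        Submodule.Quotient.mk_eq_zero, Submodule.mem_comap]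
      have h0 : π a = 0 := ha.1
      simp [h0]
    · intro y hy
      obtain ⟨⟨a, ha⟩, rfl⟩ := Submodule.Quotient.mk_surjective _ y
      rw [LinearMap.mem_ker, hf2 a ha ⟨a, ha.1, rfl⟩, Submodule.Quotient.mk_eq_zero,
        Submodule.mem_comap] at hy
      obtain ⟨c, hc, hca⟩ := lieSpan_bkSet_inter_map_le hπ hπs hRT hy
      have hca : π c = π a := hca
      have hcT := lieSpan_bkSet_inter_le sF hT hc
      have hk : a - c ∈ LinearMap.ker π ⊓ derived sF :=
        ⟨by simp [hca], sub_mem ha.2 hcT.2⟩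
      refine ⟨Submodule.Quotient.mk ⟨a - c, hk⟩, ?_⟩
      rw [hf1 _ hk (sub_mem ha hcT), Submodule.Quotient.eq, Submodule.mem_comap]
      simpa using hc
  · apply le_antisymm
    · rintro _ ⟨y, rfl⟩
      obtain ⟨⟨a, ha⟩, rfl⟩ := Submodule.Quotient.mk_surjective _ y
      have hb : π a ∈ T.map π := ⟨a, ha.1, rfl⟩
      rw [LinearMap.mem_ker, hf2 a ha hb, hf3 _ hb, Submodule.Quotient.mk_eq_zero,
        ← map_derived hπ hπs]
      exact ⟨a, ha.2, rfl⟩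
    · intro y hy
      obtain ⟨⟨b, hb⟩, rfl⟩ := Submodule.Quotient.mk_surjective _ y
      rw [LinearMap.mem_ker, hf3 _ hb, Submodule.Quotient.mk_eq_zero,
        ← map_derived hπ hπs] at hy
      obtain ⟨a, ha, rfl⟩ := hy
      exact ⟨Submodule.Quotient.mk ⟨a, mem_of_map_mem_map hRT hb, ha⟩, hf2 a _ hb⟩
  · apply le_antisymm
    · rintro _ ⟨y, rfl⟩
      obtain ⟨⟨b, hb⟩, rfl⟩ := Submodule.Quotient.mk_surjective _ y
      have h0 : p b = 0 := by rwa [← LinearMap.mem_ker, hpker]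
      rw [LinearMap.mem_ker, hf3 _ hb, hf4, h0, Submodule.Quotient.mk_zero]
    · intro y hy
      obtain ⟨b, rfl⟩ := Submodule.Quotient.mk_surjective _ y
      rw [LinearMap.mem_ker, hf4, Submodule.Quotient.mk_eq_zero, ← map_derived hp hps] at hy
      obtain ⟨c, hc, hcb⟩ := hy
      have hm : b - c ∈ T.map π := by
        rw [← hpker, LinearMap.mem_ker, map_sub, hcb, sub_self]
      refine ⟨Submodule.Quotient.mk ⟨b - c, hm⟩, ?_⟩
      rw [hf3 _ hm, Submodule.Quotient.eq]
      simpa using hc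
  · intro y
    obtain ⟨q, rfl⟩ := Submodule.Quotient.mk_surjective _ y
    obtain ⟨b, rfl⟩ := hps q
    exact ⟨Submodule.Quotient.mk b, hf4 b⟩

end BogomolovSuper
end

section
/- Let e: 0 → M →^χ C →^π L → 0 be a central extension of Lie superalgebras. Then e is a commutativity preserving (CP) extension if and only if χ(M) ∩ K(C) = 0. -/
/-!
Basic definitions for Lie superalgebras over a commutative ring `K`,
graded ideals, the nonabelian (CP) exterior products and the Bogomolov multiplier.
-/

universe u v

namespace BogomolovSuper

/-- If every element of the image of a super homomorphism `χ` brackets to zero on the left, then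
every element of the image also brackets to zero on the right. -/
theorem bk_range_eq_zero_of_left
    {K : Type u} [CommRing K] {M C : Type v}
    [AddCommGroup M] [Module K M] [AddCommGroup C] [Module K C]
    (sM : SuperAlg K M) (sC : SuperAlg K C)
    (χ : M →ₗ[K] C) (hχ : IsSuperHom sM sC χ)
    (hcentral : ∀ x ∈ LinearMap.range χ, ∀ c : C, sC.bk x c = 0)
    (c : C) (m : M) : sC.bk c (χ m) = 0 := by
  have hom : ∀ i j : ZMod 2, ∀ a ∈ sC.gr i, ∀ b ∈ sM.gr j, sC.bk a (χ b) = 0 := by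
    intro i j a ha b hb
    rw [sC.skew i j a ha (χ b) (hχ.2 j b hb), hcentral _ ⟨b, rfl⟩, smul_zero, neg_zero]
  obtain ⟨c₀, hc₀, c₁, hc₁, rfl⟩ :=
    Submodule.mem_sup.1 (sC.gr_sup ▸ Submodule.mem_top : c ∈ sC.gr 0 ⊔ sC.gr 1)
  obtain ⟨m₀, hm₀, m₁, hm₁, rfl⟩ :=
    Submodule.mem_sup.1 (sM.gr_sup ▸ Submodule.mem_top : m ∈ sM.gr 0 ⊔ sM.gr 1)
  simp only [map_add, LinearMap.add_apply, hom 0 0 c₀ hc₀ m₀ hm₀, hom 0 1 c₀ hc₀ m₁ hm₁,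
    hom 1 0 c₁ hc₁ m₀ hm₀, hom 1 1 c₁ hc₁ m₁ hm₁, add_zero]

/-- Let `e : 0 → M →χ C →π L → 0` be a central extension of Lie
superalgebras.  Then `e` is a commutativity preserving (CP) extension (commuting
pairs of elements of `L` have commuting lifts in `C`) if and only if
`χ(M) ∩ K(C) = 0`. -/
theorem central_extension_cp_iff
    {K : Type u} [CommRing K] {M C L : Type v}
    [AddCommGroup M] [Module K M] [AddCommGroup C] [Module K C]
    [AddCommGroup L] [Module K L]
    (sM : SuperAlg K M) (sC : SuperAlg K C) (sL : SuperAlg K L)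
    (χ : M →ₗ[K] C) (hχ : IsSuperHom sM sC χ) (hχinj : Function.Injective χ)
    (π : C →ₗ[K] L) (hπ : IsSuperHom sC sL π) (hπsurj : Function.Surjective π)
    (hexact : LinearMap.range χ = LinearMap.ker π)
    (hcentral : ∀ x ∈ LinearMap.range χ, ∀ c : C, sC.bk x c = 0) :
    (∀ x y : L, sL.bk x y = 0 →
        ∃ x' y' : C, π x' = x ∧ π y' = y ∧ sC.bk x' y' = 0) ↔
      (∀ z ∈ LinearMap.range χ, z ∈ bkSet sC → z = 0) := by
  constructor
  · rintro hcp z hz ⟨a, b, rfl⟩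
    have hab : sL.bk (π a) (π b) = 0 := by
      rw [← hπ.1]
      exact LinearMap.mem_ker.1 (hexact ▸ hz)
    obtain ⟨a', b', ha, hb, h⟩ := hcp _ _ hab
    have ha' : a - a' ∈ LinearMap.range χ := by
      rw [hexact, LinearMap.mem_ker, map_sub, ha, sub_self]
    have hb' : b - b' ∈ LinearMap.range χ := by
      rw [hexact, LinearMap.mem_ker, map_sub, hb, sub_self]
    obtain ⟨n, hn⟩ := hb'
    calc sC.bk a b = sC.bk (a - a') b + sC.bk a' (b - b') + sC.bk a' b' := by
          simp only [map_sub, LinearMap.sub_apply]; abel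
      _ = 0 := by
          rw [hcentral _ ha', ← hn, bk_range_eq_zero_of_left sM sC χ hχ hcentral, h,
            add_zero, add_zero]
  · intro hK x y hxy
    obtain ⟨a, rfl⟩ := hπsurj x
    obtain ⟨b, rfl⟩ := hπsurj y
    refine ⟨a, b, rfl, rfl, hK _ ?_ ⟨a, b, rfl⟩⟩
    rw [hexact, LinearMap.mem_ker, hπ.1, hxy]

end BogomolovSuper
end

section
/- Let L₁ and L₂ be Lie superalgebras. Then B̃₀(L₁ ⊕ L₂) ≅ B̃₀(L₁) ⊕ B̃₀(L₂), where L₁ ⊕ L₂ is the direct sum Lie superalgebra with even part (L₁)₀ ⊕ (L₂)₀ and odd part (L₁)₁ ⊕ (L₂)₁. -/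
/-!
Basic definitions for Lie superalgebras over a commutative ring `K`,
graded ideals, the nonabelian (CP) exterior products and the Bogomolov multiplier.
-/

universe u v

namespace BogomolovSuper

section Functoriality

variable {K : Type u} [CommRing K] {L L' E E' : Type v}
  [AddCommGroup L] [Module K L] [AddCommGroup L'] [Module K L']
  [AddCommGroup E] [Module K E] [AddCommGroup E'] [Module K E']
  {s : SuperAlg K L} {s' : SuperAlg K L'} {t : SuperAlg K E} {t' : SuperAlg K E'}
  {φ : L →ₗ[K] L'} {w : L → L → E} {w' : L' → L' → E'}

/-- Exterior pairings pull back along homomorphisms of Lie superalgebras. -/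
theorem IsExtPairing.comp (h : IsExtPairing s' ⊤ ⊤ t' w') (hφ : IsSuperHom s s' φ) :
    IsExtPairing s ⊤ ⊤ t' (fun x y => w' (φ x) (φ y)) := by
  have hm : ∀ {i : ZMod 2} {x : L}, x ∈ ⊤ ⊓ s.gr i → φ x ∈ ⊤ ⊓ s'.gr i :=
    fun hx => ⟨trivial, hφ.2 _ _ hx.2⟩
  constructor
  · intro i j m hm₁ n hn
    exact h.grade i j _ (hm hm₁) _ (hm hn)
  · intro c i j m hm₁ n hn
    simpa only [map_smul] using h.smul_left c i j _ (hm hm₁) _ (hm hn)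
  · intro c i j m hm₁ n hn
    simpa only [map_smul] using h.smul_right c i j _ (hm hm₁) _ (hm hn)
  · intro i j m hm₁ m' hm₂ n hn
    simpa only [map_add] using h.add_left i j _ (hm hm₁) _ (hm hm₂) _ (hm hn)
  · intro i j m hm₁ n hn n' hn'
    simpa only [map_add] using h.add_right i j _ (hm hm₁) _ (hm hn) _ (hm hn')
  · intro i i' j m hm₁ m' hm₂ n hn
    simpa only [hφ.1] using h.bk_left i i' j _ (hm hm₁) _ (hm hm₂) _ (hm hn)
  · intro i j j' m hm₁ n hn n' hn'
    simpa only [hφ.1] using h.bk_right i j j' _ (hm hm₁) _ (hm hn) _ (hm hn')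
  · intro i j i' j' m hm₁ n hn m' hm₂ n' hn'
    simpa only [hφ.1] using
      h.bk_pair i j i' j' _ (hm hm₁) _ (hm hn) _ (hm hm₂) _ (hm hn')

theorem IsExtPairing.zero_left (h : IsExtPairing s ⊤ ⊤ t w) {j : ZMod 2} {y : L}
    (hy : y ∈ s.gr j) : w 0 y = 0 := by
  simpa using h.smul_left 0 0 j 0 (Submodule.zero_mem _) y ⟨trivial, hy⟩

/-- A homomorphism of Lie superalgebras induces a linear map of exterior squares. -/
theorem IsExtProduct.exists_map (hW : IsExtProduct s ⊤ ⊤ t w)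
    (hW' : IsExtProduct s' ⊤ ⊤ t' w') (hφ : IsSuperHom s s' φ) :
    ∃ f : E →ₗ[K] E', ∀ (i j : ZMod 2), ∀ m ∈ s.gr i, ∀ n ∈ s.gr j,
      f (w m n) = w' (φ m) (φ n) := by
  obtain ⟨f, -, hf⟩ := hW.lift t' _ (hW'.pairing.comp hφ)
  exact ⟨f, fun i j m hm n hn => hf i j m ⟨trivial, hm⟩ n ⟨trivial, hn⟩⟩

/-- A property of elements of the exterior square closed under linear combinations may be
checked on wedges of homogeneous elements. -/
theorem IsExtProduct.mem_of_wedge (hW : IsExtProduct s ⊤ ⊤ t w) (p : Submodule K E)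
    (h : ∀ (i j : ZMod 2), ∀ m ∈ s.gr i, ∀ n ∈ s.gr j, w m n ∈ p) (x : E) : x ∈ p := by
  have hp : Submodule.span K (wedgeSet s ⊤ ⊤ w) ≤ p := by
    rw [Submodule.span_le]
    rintro _ ⟨i, j, m, hm, n, hn, rfl⟩
    exact h i j m hm.2 n hn.2
  exact hp (hW.gen ▸ Submodule.mem_top)

theorem IsExtProduct.linearMap_ext (hW : IsExtProduct s ⊤ ⊤ t w) {N : Type v}
    [AddCommGroup N] [Module K N] {f g : E →ₗ[K] N}
    (h : ∀ (i j : ZMod 2), ∀ m ∈ s.gr i, ∀ n ∈ s.gr j, f (w m n) = g (w m n)) (x : E) :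
    f x = g x :=
  hW.mem_of_wedge (LinearMap.eqLocus f g) h x

/-- Every wedge of commuting homogeneous elements lies in `M₀`. -/
theorem IsExtPairing.wedge_mem_M0 (h : IsExtPairing s ⊤ ⊤ t w) {i j : ZMod 2} {m n : L}
    (hm : m ∈ s.gr i) (hn : n ∈ s.gr j) (hmn : s.bk m n = 0) : w m n ∈ M0 s ⊤ ⊤ w := by
  refine Submodule.subset_span (Or.inl ⟨i, j, 0, 0, m, ⟨trivial, hm⟩, n, ⟨trivial, hn⟩,
    0, Submodule.zero_mem _, 0, Submodule.zero_mem _, ?_, ?_⟩)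
  · simp [hmn]
  · simp [h.zero_left (s.gr 0).zero_mem]

/-- Maps of exterior squares induced by homomorphisms preserve `M₀`. -/
theorem M0_le_comap (hφ : IsSuperHom s s' φ) {f : E →ₗ[K] E'}
    (hf : ∀ (i j : ZMod 2), ∀ m ∈ s.gr i, ∀ n ∈ s.gr j, f (w m n) = w' (φ m) (φ n)) :
    M0 s ⊤ ⊤ w ≤ (M0 s' ⊤ ⊤ w').comap f := by
  have hm : ∀ {i : ZMod 2} {x : L}, x ∈ ⊤ ⊓ s.gr i → φ x ∈ ⊤ ⊓ s'.gr i :=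
    fun hx => ⟨trivial, hφ.2 _ _ hx.2⟩
  refine Submodule.span_le.2 ?_
  rintro _ (⟨i, j, i', j', m, hm₁, n, hn, m', hm', n', hn', h, rfl⟩ | ⟨m, hm₁, n, hn, h, rfl⟩)
  · refine Submodule.subset_span (Or.inl ⟨i, j, i', j', φ m, hm hm₁, φ n, hm hn,
      φ m', hm hm', φ n', hm hn', ?_, ?_⟩)
    · simpa [hφ.1] using congrArg φ h
    · simp [hf i j m hm₁.2 n hn.2, hf i' j' m' hm'.2 n' hn'.2]
  · refine Submodule.subset_span (Or.inr ⟨φ m, hm hm₁, φ n, hm hn, ?_, ?_⟩)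
    · simpa [hφ.1] using congrArg φ h
    · exact hf 0 0 m hm₁.2 n hn.2

/-- The commutator maps are natural. -/
theorem IsCommMap.naturality (hW : IsExtProduct s ⊤ ⊤ t w) (hφ : IsSuperHom s s' φ)
    {f : E →ₗ[K] E'}
    (hf : ∀ (i j : ZMod 2), ∀ m ∈ s.gr i, ∀ n ∈ s.gr j, f (w m n) = w' (φ m) (φ n))
    {κ : E →ₗ[K] L} (hκ : IsCommMap s ⊤ ⊤ w κ)
    {κ' : E' →ₗ[K] L'} (hκ' : IsCommMap s' ⊤ ⊤ w' κ') (x : E) : κ' (f x) = φ (κ x) := by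
  refine hW.linearMap_ext (f := κ' ∘ₗ f) (g := φ ∘ₗ κ) (fun i j m hm n hn => ?_) x
  simp [hf i j m hm n hn, hκ i j m ⟨trivial, hm⟩ n ⟨trivial, hn⟩,
    hκ' i j _ ⟨trivial, hφ.2 i m hm⟩ _ ⟨trivial, hφ.2 j n hn⟩, hφ.1]

/-- Maps of exterior squares induced by homomorphisms send `ker κ` to `ker κ'`. -/
theorem IsCommMap.map_mem_ker (hW : IsExtProduct s ⊤ ⊤ t w) (hφ : IsSuperHom s s' φ)
    {f : E →ₗ[K] E'}
    (hf : ∀ (i j : ZMod 2), ∀ m ∈ s.gr i, ∀ n ∈ s.gr j, f (w m n) = w' (φ m) (φ n))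
    {κ : E →ₗ[K] L} (hκ : IsCommMap s ⊤ ⊤ w κ)
    {κ' : E' →ₗ[K] L'} (hκ' : IsCommMap s' ⊤ ⊤ w' κ') :
    ∀ x ∈ LinearMap.ker κ, f x ∈ LinearMap.ker κ' := fun x hx => by
  rw [LinearMap.mem_ker, hκ.naturality hW hφ hf hκ', LinearMap.mem_ker.1 hx, map_zero]

end Functoriality

section DirectSum

variable {K : Type u} [CommRing K] {L₁ L₂ P : Type v}
  [AddCommGroup L₁] [Module K L₁] [AddCommGroup L₂] [Module K L₂]
  [AddCommGroup P] [Module K P] {s₁ : SuperAlg K L₁} {s₂ : SuperAlg K L₂} {sP : SuperAlg K P}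
  {ι₁ : L₁ →ₗ[K] P} {ι₂ : L₂ →ₗ[K] P}

theorem SuperAlg.exists_homogeneous_add (s : SuperAlg K P) (x : P) :
    ∃ a ∈ s.gr 0, ∃ b ∈ s.gr 1, a + b = x :=
  Submodule.mem_sup.1 (s.gr_sup ▸ Submodule.mem_top)

theorem SuperAlg.bk_eq_zero_comm_of_mem (s : SuperAlg K P) {i j : ZMod 2} {x y : P}
    (hx : x ∈ s.gr i) (hy : y ∈ s.gr j) (h : s.bk y x = 0) : s.bk x y = 0 := by
  rw [s.skew i j x hx y hy, h, smul_zero, neg_zero]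

/-- If the images of two homomorphisms commute in one order, they commute in the other. -/
theorem cross_bk_symm (h₁ : IsSuperHom s₁ sP ι₁) (h₂ : IsSuperHom s₂ sP ι₂)
    (hcross : ∀ (x : L₁) (y : L₂), sP.bk (ι₁ x) (ι₂ y) = 0) (y : L₂) (x : L₁) :
    sP.bk (ι₂ y) (ι₁ x) = 0 := by
  obtain ⟨a, ha, b, hb, rfl⟩ := s₁.exists_homogeneous_add x
  obtain ⟨c, hc, d, hd, rfl⟩ := s₂.exists_homogeneous_add y
  have h : ∀ {i j : ZMod 2} {u : L₁} {v : L₂}, u ∈ s₁.gr i → v ∈ s₂.gr j →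
      sP.bk (ι₂ v) (ι₁ u) = 0 := fun hu hv =>
    sP.bk_eq_zero_comm_of_mem (h₂.2 _ _ hv) (h₁.2 _ _ hu) (hcross _ _)
  simp [h ha hc, h ha hd, h hb hc, h hb hd]

/-- The projection of a direct sum onto a summand is a homomorphism. -/
theorem isSuperHom_proj (h₁ : IsSuperHom s₁ sP ι₁) (h₂ : IsSuperHom s₂ sP ι₂)
    (hcross : ∀ (x : L₁) (y : L₂), sP.bk (ι₁ x) (ι₂ y) = 0)
    (hgr : ∀ i : ZMod 2, sP.gr i = (s₁.gr i).map ι₁ ⊔ (s₂.gr i).map ι₂)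
    (hsurj : ∀ p : P, ∃ x y, ι₁ x + ι₂ y = p) {π : P →ₗ[K] L₁}
    (hπ₁ : ∀ x, π (ι₁ x) = x) (hπ₂ : ∀ y, π (ι₂ y) = 0) : IsSuperHom sP s₁ π := by
  constructor
  · intro p q
    obtain ⟨a, b, rfl⟩ := hsurj p
    obtain ⟨c, d, rfl⟩ := hsurj q
    simp [hcross, cross_bk_symm h₁ h₂ hcross, ← h₁.1, ← h₂.1, hπ₁, hπ₂]
  · intro i p hp
    rw [hgr, Submodule.mem_sup] at hp
    obtain ⟨_, ⟨a, ha, rfl⟩, _, ⟨b, -, rfl⟩, rfl⟩ := hp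
    simpa [hπ₁, hπ₂] using ha

end DirectSum

/-- For Lie superalgebras `L₁`, `L₂`,
`B̃₀(L₁ ⊕ L₂) ≅ B̃₀(L₁) ⊕ B̃₀(L₂)`.  The direct sum `P = L₁ ⊕ L₂` is specified by
bracket- and grading-preserving embeddings `ι₁, ι₂` such that `(x,y) ↦ ι₁ x + ι₂ y`
is a linear bijection and `[ι₁ L₁, ι₂ L₂] = 0` (so `gr P i = gr L₁ i ⊕ gr L₂ i`);
each `B̃₀` is `M/M₀` computed from a realization of the corresponding exterior
product and commutator map. -/
theorem bogomolov_of_direct_sum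
    {K : Type u} [CommRing K] {L₁ L₂ P E E₁ E₂ : Type v}
    [AddCommGroup L₁] [Module K L₁] [AddCommGroup L₂] [Module K L₂]
    [AddCommGroup P] [Module K P] [AddCommGroup E] [Module K E]
    [AddCommGroup E₁] [Module K E₁] [AddCommGroup E₂] [Module K E₂]
    (s₁ : SuperAlg K L₁) (s₂ : SuperAlg K L₂) (sP : SuperAlg K P)
    (ι₁ : L₁ →ₗ[K] P) (ι₂ : L₂ →ₗ[K] P)
    (hι₁ : IsSuperHom s₁ sP ι₁) (hι₂ : IsSuperHom s₂ sP ι₂)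
    (hbij : Function.Bijective (ι₁.coprod ι₂))
    (hcross : ∀ (x : L₁) (y : L₂), sP.bk (ι₁ x) (ι₂ y) = 0)
    (hgr : ∀ i : ZMod 2, sP.gr i = (s₁.gr i).map ι₁ ⊔ (s₂.gr i).map ι₂)
    (tW : SuperAlg K E) (w : P → P → E) (hW : IsExtProduct sP ⊤ ⊤ tW w)
    (κ : E →ₗ[K] P) (hκ : IsCommMap sP ⊤ ⊤ w κ)
    (tW₁ : SuperAlg K E₁) (w₁ : L₁ → L₁ → E₁) (hW₁ : IsExtProduct s₁ ⊤ ⊤ tW₁ w₁)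
    (κ₁ : E₁ →ₗ[K] L₁) (hκ₁ : IsCommMap s₁ ⊤ ⊤ w₁ κ₁)
    (tW₂ : SuperAlg K E₂) (w₂ : L₂ → L₂ → E₂) (hW₂ : IsExtProduct s₂ ⊤ ⊤ tW₂ w₂)
    (κ₂ : E₂ →ₗ[K] L₂) (hκ₂ : IsCommMap s₂ ⊤ ⊤ w₂ κ₂) :
    Nonempty (
      (↥(LinearMap.ker κ) ⧸
        Submodule.comap (LinearMap.ker κ).subtype (M0 sP ⊤ ⊤ w)) ≃ₗ[K]
      ((↥(LinearMap.ker κ₁) ⧸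
          Submodule.comap (LinearMap.ker κ₁).subtype (M0 s₁ ⊤ ⊤ w₁)) ×
       (↥(LinearMap.ker κ₂) ⧸
          Submodule.comap (LinearMap.ker κ₂).subtype (M0 s₂ ⊤ ⊤ w₂)))) := by
  have hsurj : ∀ p : P, ∃ x y, ι₁ x + ι₂ y = p := fun p => by
    obtain ⟨⟨x, y⟩, h⟩ := hbij.2 p
    exact ⟨x, y, by simpa using h⟩
  have hcross' := cross_bk_symm hι₁ hι₂ hcross
  obtain ⟨π₁, hπ₁₁, hπ₁₂, π₂, hπ₂₁, hπ₂₂⟩ : ∃ π₁ : P →ₗ[K] L₁,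
      (∀ x, π₁ (ι₁ x) = x) ∧ (∀ y, π₁ (ι₂ y) = 0) ∧ ∃ π₂ : P →ₗ[K] L₂,
      (∀ x, π₂ (ι₁ x) = 0) ∧ (∀ y, π₂ (ι₂ y) = y) := by
    let e := LinearEquiv.ofBijective (ι₁.coprod ι₂) hbij
    have he₁ : ∀ x, e.symm (ι₁ x) = (x, 0) := fun x => by
      rw [LinearEquiv.symm_apply_eq]; simp [e]
    have he₂ : ∀ y, e.symm (ι₂ y) = (0, y) := fun y => by
      rw [LinearEquiv.symm_apply_eq]; simp [e]
    exact ⟨LinearMap.fst K L₁ L₂ ∘ₗ e.symm, by simp [he₁], by simp [he₂],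
      LinearMap.snd K L₁ L₂ ∘ₗ e.symm, by simp [he₁], by simp [he₂]⟩
  have hπ₁ : IsSuperHom sP s₁ π₁ := isSuperHom_proj hι₁ hι₂ hcross hgr hsurj hπ₁₁ hπ₁₂
  have hπ₂ : IsSuperHom sP s₂ π₂ :=
    isSuperHom_proj hι₂ hι₁ hcross' (fun i => (hgr i).trans (sup_comm _ _))
      (fun p => let ⟨x, y, h⟩ := hsurj p; ⟨y, x, by rw [add_comm, h]⟩) hπ₂₂ hπ₂₁
  obtain ⟨f₁, hf₁⟩ := hW.exists_map hW₁ hπ₁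
  obtain ⟨f₂, hf₂⟩ := hW.exists_map hW₂ hπ₂
  obtain ⟨g₁, hg₁⟩ := hW₁.exists_map hW hι₁
  obtain ⟨g₂, hg₂⟩ := hW₂.exists_map hW hι₂
  have hfg₁₁ : ∀ x, f₁ (g₁ x) = x :=
    hW₁.linearMap_ext (f := f₁ ∘ₗ g₁) (g := LinearMap.id) fun i j m hm n hn => by
      simp [hg₁ i j m hm n hn, hf₁ i j _ (hι₁.2 i m hm) _ (hι₁.2 j n hn), hπ₁₁]
  have hfg₂₂ : ∀ x, f₂ (g₂ x) = x :=
    hW₂.linearMap_ext (f := f₂ ∘ₗ g₂) (g := LinearMap.id) fun i j m hm n hn => by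
      simp [hg₂ i j m hm n hn, hf₂ i j _ (hι₂.2 i m hm) _ (hι₂.2 j n hn), hπ₂₂]
  have hfg₁₂ : ∀ x, f₁ (g₂ x) = 0 :=
    hW₂.linearMap_ext (f := f₁ ∘ₗ g₂) (g := 0) fun i j m hm n hn => by
      simp [hg₂ i j m hm n hn, hf₁ i j _ (hι₂.2 i m hm) _ (hι₂.2 j n hn), hπ₁₂,
        hW₁.pairing.zero_left (s₁.gr 0).zero_mem]
  have hfg₂₁ : ∀ x, f₂ (g₁ x) = 0 :=
    hW₁.linearMap_ext (f := f₂ ∘ₗ g₁) (g := 0) fun i j m hm n hn => by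
      simp [hg₁ i j m hm n hn, hf₂ i j _ (hι₁.2 i m hm) _ (hι₁.2 j n hn), hπ₂₁,
        hW₂.pairing.zero_left (s₂.gr 0).zero_mem]
  have hgf : ∀ x, x - (g₁ (f₁ x) + g₂ (f₂ x)) ∈ M0 sP ⊤ ⊤ w := by
    refine hW.mem_of_wedge
      ((M0 sP ⊤ ⊤ w).comap (LinearMap.id - (g₁ ∘ₗ f₁ + g₂ ∘ₗ f₂))) fun i j p hp q hq => ?_
    have ha := hπ₁.2 i p hp
    have hb := hπ₂.2 i p hp
    have hc := hπ₁.2 j q hq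
    have hd := hπ₂.2 j q hq
    have hp' : p = ι₁ (π₁ p) + ι₂ (π₂ p) := by
      obtain ⟨x, y, rfl⟩ := hsurj p
      simp [hπ₁₁, hπ₁₂, hπ₂₁, hπ₂₂]
    have hq' : q = ι₁ (π₁ q) + ι₂ (π₂ q) := by
      obtain ⟨x, y, rfl⟩ := hsurj q
      simp [hπ₁₁, hπ₁₂, hπ₂₁, hπ₂₂]
    have hexp : w p q = w (ι₁ (π₁ p)) (ι₁ (π₁ q)) + w (ι₁ (π₁ p)) (ι₂ (π₂ q)) +
        (w (ι₂ (π₂ p)) (ι₁ (π₁ q)) + w (ι₂ (π₂ p)) (ι₂ (π₂ q))) := by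
      have h₁ := hW.pairing.add_left i j _ ⟨trivial, hι₁.2 i _ ha⟩ _
        ⟨trivial, hι₂.2 i _ hb⟩ q ⟨trivial, hq⟩
      have h₂ := fun (r : P) (hr : r ∈ sP.gr i) => hW.pairing.add_right i j r ⟨trivial, hr⟩ _
        ⟨trivial, hι₁.2 j _ hc⟩ _ ⟨trivial, hι₂.2 j _ hd⟩
      rw [← hp'] at h₁
      rw [← hq'] at h₂
      rw [h₁, h₂ _ (hι₁.2 i _ ha), h₂ _ (hι₂.2 i _ hb)]
    have hmem := Submodule.add_mem _
      (hW.pairing.wedge_mem_M0 (hι₁.2 i _ ha) (hι₂.2 j _ hd) (hcross _ _))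
      (hW.pairing.wedge_mem_M0 (hι₂.2 i _ hb) (hι₁.2 j _ hc) (hcross' _ _))
    change w p q - (g₁ (f₁ (w p q)) + g₂ (f₂ (w p q))) ∈ M0 sP ⊤ ⊤ w
    rw [hf₁ i j p hp q hq, hf₂ i j p hp q hq, hg₁ i j _ ha _ hc, hg₂ i j _ hb _ hd, hexp]
    convert hmem using 1
    abel
  have kf₁ := hκ.map_mem_ker hW hπ₁ hf₁ hκ₁
  have kf₂ := hκ.map_mem_ker hW hπ₂ hf₂ hκ₂
  have kg₁ := hκ₁.map_mem_ker hW₁ hι₁ hg₁ hκ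
  have kg₂ := hκ₂.map_mem_ker hW₂ hι₂ hg₂ hκ
  let Φ := (Submodule.mkQ (Submodule.comap (LinearMap.ker κ₁).subtype (M0 s₁ ⊤ ⊤ w₁)) ∘ₗ
      f₁.restrict kf₁).prod
    (Submodule.mkQ (Submodule.comap (LinearMap.ker κ₂).subtype (M0 s₂ ⊤ ⊤ w₂)) ∘ₗ
      f₂.restrict kf₂)
  have hΦsurj : Function.Surjective Φ := by
    rintro ⟨a, b⟩
    obtain ⟨⟨a, ha⟩, rfl⟩ := Submodule.mkQ_surjective _ a
    obtain ⟨⟨b, hb⟩, rfl⟩ := Submodule.mkQ_surjective _ b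
    refine ⟨⟨g₁ a + g₂ b, add_mem (kg₁ a ha) (kg₂ b hb)⟩, ?_⟩
    simp [Φ, LinearMap.restrict_apply, hfg₁₁, hfg₂₂, hfg₁₂, hfg₂₁]
  have hΦker : Submodule.comap (LinearMap.ker κ).subtype (M0 sP ⊤ ⊤ w) = LinearMap.ker Φ := by
    have hiff : ∀ x, x ∈ LinearMap.ker Φ ↔
        f₁ x ∈ M0 s₁ ⊤ ⊤ w₁ ∧ f₂ x ∈ M0 s₂ ⊤ ⊤ w₂ := fun x => by
      simp [Φ, Submodule.Quotient.mk_eq_zero]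
    ext x
    rw [hiff, Submodule.mem_comap, Submodule.subtype_apply]
    refine ⟨fun h => ⟨M0_le_comap hπ₁ hf₁ h, M0_le_comap hπ₂ hf₂ h⟩, fun ⟨h₁, h₂⟩ => ?_⟩
    exact sub_add_cancel (x : E) _ ▸ Submodule.add_mem _ (hgf x)
      (Submodule.add_mem _ (M0_le_comap hι₁ hg₁ h₁) (M0_le_comap hι₂ hg₂ h₂))
  exact ⟨(Submodule.quotEquivOfEq _ _ hΦker).trans (Φ.quotKerEquivOfSurjective hΦsurj)⟩

end BogomolovSuper
end
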